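/- An aperiodic recurrent infinite word is Sturmian if and only if each of its factors has two or three abelian returns. -/

import Mathlib

variable {α : Type*}

/-- The factor of the infinite word `w` of length `n` starting at position `i`. -/
def factorAt (w : ℕ → α) (i n : ℕ) : List α :=
  (List.range n).map fun k => w (i + k)

/-- `u` is a factor of the infinite word `w`. -/
def IsFactor (w : ℕ → α) (u : List α) : Prop :=
  ∃ i, factorAt w i u.length = u

/-- `w` is recurrent: each of its factors occurs infinitely many times. -/
def Recurrent (w : ℕ → α) : Prop :=
  ∀ u : List α, IsFactor w u → ∀ N : ℕ, ∃ i, N ≤ i ∧ factorAt w i u.length = u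

/-- `w` is periodic: there is `T > 0` with `w (n + T) = w n` for all `n`. -/
def Periodic (w : ℕ → α) : Prop :=
  ∃ T : ℕ, 0 < T ∧ ∀ n, w (n + T) = w n

def Aperiodic (w : ℕ → α) : Prop := ¬ Periodic w

def UltimatelyPeriodic (w : ℕ → α) : Prop :=
  ∃ N T : ℕ, 0 < T ∧ ∀ n, N ≤ n → w (n + T) = w n

/-- `w` is Sturmian: aperiodic with subword complexity `n + 1`. -/
def Sturmian (w : ℕ → α) : Prop :=
  Aperiodic w ∧ ∀ n : ℕ, {u : List α | u.length = n ∧ IsFactor w u}.ncard = n + 1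

/-- Positions where `u` occurs in `w`. -/
def Occurrences (w : ℕ → α) (u : List α) : Set ℕ :=
  {i | factorAt w i u.length = u}

/-- The return words of `u` in `w`: words from one occurrence of `u` to the next. -/
def ReturnWords (w : ℕ → α) (u : List α) : Set (List α) :=
  {r | ∃ i j : ℕ, i ∈ Occurrences w u ∧ j ∈ Occurrences w u ∧ i < j ∧
    (∀ k, i < k → k < j → k ∉ Occurrences w u) ∧ r = factorAt w i (j - i)}

/-- Positions where a word abelian-equivalent to `u` occurs in `w`. -/
def AbelianOccurrences (w : ℕ → α) (u : List α) : Set ℕ :=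
  {i | List.Perm (factorAt w i u.length) u}

/-- The abelian return words of `u` in `w`. -/
def AbelianReturnWords (w : ℕ → α) (u : List α) : Set (List α) :=
  {r | ∃ i j : ℕ, i ∈ AbelianOccurrences w u ∧ j ∈ AbelianOccurrences w u ∧ i < j ∧
    (∀ k, i < k → k < j → k ∉ AbelianOccurrences w u) ∧ r = factorAt w i (j - i)}

/-- The abelian equivalence classes (as multisets) of the abelian return words of `u` in `w`. -/
def abelianReturnClasses (w : ℕ → α) (u : List α) : Set (Multiset α) :=
  (fun r : List α => (r : Multiset α)) '' AbelianReturnWords w u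

def RightSpecial (w : ℕ → α) (u : List α) : Prop :=
  ∃ a b : α, a ≠ b ∧ IsFactor w (u ++ [a]) ∧ IsFactor w (u ++ [b])

def LeftSpecial (w : ℕ → α) (u : List α) : Prop :=
  ∃ a b : α, a ≠ b ∧ IsFactor w (a :: u) ∧ IsFactor w (b :: u)

def Bispecial (w : ℕ → α) (u : List α) : Prop :=
  RightSpecial w u ∧ LeftSpecial w u

/-- A factor is singular if it is the only factor of `w` in its abelian class. -/
def Singular (w : ℕ → α) (u : List α) : Prop :=
  ∀ v : List α, IsFactor w v → List.Perm v u → v = u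

/-- `w` is an infinite concatenation of words from `S`. -/
def InfConcat (S : Set (List α)) (w : ℕ → α) : Prop :=
  ∃ f : ℕ → List α, (∀ n, f n ∈ S) ∧
    ∀ n, factorAt w (((List.range n).map fun k => (f k).length).sum) (f n).length = f n

/-- A finite binary word is balanced if any two factors of equal length have numbers
of occurrences of `true` differing by at most one. -/
def BalancedList (w : List Bool) : Prop :=
  ∀ u v : List Bool, u <:+: w → v <:+: w → u.length = v.length →
    |(u.count true : ℤ) - (v.count true : ℤ)| ≤ 1

/-- Number of ones among the first `i` letters of a `0`-`1` word, as an integer. -/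
def prefixSum (x : ℕ → ℤ) (i : ℕ) : ℤ := ∑ k ∈ Finset.range i, x k

def IsBinary (x : ℕ → ℤ) : Prop := ∀ i, x i = 0 ∨ x i = 1

/-- Every factor of `x` occurs beyond any given position. -/
def FactorsRecur (x : ℕ → ℤ) : Prop :=
  ∀ i n N : ℕ, ∃ j, N ≤ j ∧ ∀ k < n, x (j + k) = x (i + k)

def NotEventuallyPeriodic (x : ℕ → ℤ) : Prop :=
  ∀ N T : ℕ, 0 < T → ∃ n, N ≤ n ∧ x (n + T) ≠ x n

/-- Windows of length `n` with sum `v` start at `i` and `i + ℓ` and nowhere in between, and the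
word read from one to the other has sum `c`. -/
def ReturnAt (x : ℕ → ℤ) (n : ℕ) (v : ℤ) (i ℓ : ℕ) (c : ℤ) : Prop :=
  0 < ℓ ∧ prefixSum x (i + n) - prefixSum x i = v ∧
    prefixSum x (i + ℓ + n) - prefixSum x (i + ℓ) = v ∧
    prefixSum x (i + ℓ) - prefixSum x i = c ∧
    ∀ k, 0 < k → k < ℓ → prefixSum x (i + k + n) - prefixSum x (i + k) ≠ v

/-- No abelian class of factors has four pairwise inequivalent abelian returns. -/
def AtMostThreeReturns (x : ℕ → ℤ) : Prop :=
  ∀ (n : ℕ) (v : ℤ) (i ℓ : Fin 4 → ℕ) (c : Fin 4 → ℤ),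
    (∀ t, ReturnAt x n v (i t) (ℓ t) (c t)) → ∃ t t', t < t' ∧ ℓ t = ℓ t' ∧ c t = c t'

def IsBalanced (x : ℕ → ℤ) : Prop :=
  ∀ n i j : ℕ, prefixSum x (i + n) - prefixSum x i ≤ prefixSum x (j + n) - prefixSum x j + 1

section Basic

variable {x : ℕ → ℤ}

lemma prefixSum_succ (x : ℕ → ℤ) (i : ℕ) : prefixSum x (i + 1) = prefixSum x i + x i := by
  simp [prefixSum, Finset.sum_range_succ]

lemma prefixSum_step (x : ℕ → ℤ) {i j : ℕ} (h : j = i + 1) :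
    prefixSum x j = prefixSum x i + x i := by
  rw [h, prefixSum_succ]

lemma prefixSum_bounds (hx : IsBinary x) {i j : ℕ} (h : i ≤ j) :
    prefixSum x i ≤ prefixSum x j ∧ prefixSum x j ≤ prefixSum x i + ((j : ℤ) - i) := by
  induction j, h using Nat.le_induction with
  | base => simp
  | succ j _ ih =>
    rw [prefixSum_succ]
    rcases hx j with h | h <;> rw [h] <;> push_cast <;> constructor <;> linarith [ih.1, ih.2]

lemma prefixSum_const {a : ℤ} {i j : ℕ} (h : i ≤ j) (hc : ∀ k, i ≤ k → k < j → x k = a) :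
    prefixSum x j = prefixSum x i + a * ((j : ℤ) - i) := by
  induction j, h using Nat.le_induction with
  | base => simp
  | succ j hj ih =>
    rw [prefixSum_succ, ih fun k h1 h2 => hc k h1 (by omega), hc j hj (by omega)]
    push_cast; ring

lemma prefixSum_shift {i j m : ℕ} (h : ∀ k < m, x (j + k) = x (i + k)) {k : ℕ} (hk : k ≤ m) :
    prefixSum x (j + k) - prefixSum x j = prefixSum x (i + k) - prefixSum x i := by
  induction k with
  | zero => simp
  | succ k ih =>
    have := ih (by omega)
    rw [← add_assoc, ← add_assoc, prefixSum_succ, prefixSum_succ, h k (by omega)]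
    linarith

/-- The rows at `p` and `q` both start with the first `m` letters of the word. -/
def PrefixRows (x : ℕ → ℤ) (m p q : ℕ) : Prop :=
  p < q ∧ ∀ k < m, x (p + k) = x k ∧ x (q + k) = x k

lemma PrefixRows.prefixSum {m p q : ℕ} (h : PrefixRows x m p q) {k : ℕ} (hk : k ≤ m) :
    prefixSum x (p + k) - prefixSum x p = prefixSum x k ∧
      prefixSum x (q + k) - prefixSum x q = prefixSum x k := by
  have h1 := prefixSum_shift (i := 0) (j := p) (m := m) (x := x)
    (fun k hk => by rw [(h.2 k hk).1, zero_add]) hk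
  have h2 := prefixSum_shift (i := 0) (j := q) (m := m) (x := x)
    (fun k hk => by rw [(h.2 k hk).2, zero_add]) hk
  simp only [zero_add] at h1 h2
  have : _root_.prefixSum x 0 = 0 := by simp [_root_.prefixSum]
  constructor <;> linarith

/-- A return inside the common prefix of two rows is inherited by the class of the windows
stretching from the first row to the second. -/
lemma PrefixRows.returnAt {m p q : ℕ} (h : PrefixRows x m p q) {n : ℕ} {v : ℤ} {i ℓ : ℕ} {c : ℤ}
    (hr : ReturnAt x n v i ℓ c) (hm : i + ℓ + n ≤ m) :
    ReturnAt x (q - p + n) (_root_.prefixSum x q - _root_.prefixSum x p + v) (p + i) ℓ c := by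
  obtain ⟨h0, h1, h2, h3, h4⟩ := hr
  have hpq := h.1
  have key : ∀ k ≤ ℓ, _root_.prefixSum x (p + i + k + (q - p + n)) - _root_.prefixSum x (p + i + k)
      = _root_.prefixSum x q - _root_.prefixSum x p +
        (_root_.prefixSum x (i + k + n) - _root_.prefixSum x (i + k)) := by
    intro k hk
    have e1 := (h.prefixSum (k := i + k + n) (by omega)).2
    have e2 := (h.prefixSum (k := i + k) (by omega)).1
    rw [show p + i + k + (q - p + n) = q + (i + k + n) by omega,
      show p + i + k = p + (i + k) by omega]
    linarith
  refine ⟨h0, ?_, ?_, ?_, ?_⟩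
  · have := key 0 (by omega); simp only [add_zero] at this; linarith
  · rw [key ℓ le_rfl]; linarith
  · have e1 := (h.prefixSum (k := i + ℓ) (by omega)).1
    have e2 := (h.prefixSum (k := i) (by omega)).1
    rw [show p + i + ℓ = p + (i + ℓ) by omega]
    linarith
  · intro k hk0 hk1 hk2
    rw [key k (by omega)] at hk2
    exact h4 k hk0 hk1 (by linarith)

/-- The class of windows between two rows with a long common prefix has no other returns than a
class which already has three. -/
lemma AtMostThreeReturns.restrict (h3 : AtMostThreeReturns x) {n : ℕ} {v : ℤ}
    {i₁ i₂ i₃ ℓ₁ ℓ₂ ℓ₃ : ℕ} {c₁ c₂ c₃ : ℤ}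
    (h₁ : ReturnAt x n v i₁ ℓ₁ c₁) (h₂ : ReturnAt x n v i₂ ℓ₂ c₂) (h₃ : ReturnAt x n v i₃ ℓ₃ c₃)
    (h₁₂ : ¬ (ℓ₁ = ℓ₂ ∧ c₁ = c₂)) (h₁₃ : ¬ (ℓ₁ = ℓ₃ ∧ c₁ = c₃)) (h₂₃ : ¬ (ℓ₂ = ℓ₃ ∧ c₂ = c₃)) :
    ∃ M, ∀ m p q, M ≤ m → PrefixRows x m p q → ∀ i ℓ c,
      ReturnAt x (q - p + n) (prefixSum x q - prefixSum x p + v) i ℓ c →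
        ℓ = ℓ₁ ∧ c = c₁ ∨ ℓ = ℓ₂ ∧ c = c₂ ∨ ℓ = ℓ₃ ∧ c = c₃ := by
  refine ⟨(i₁ + ℓ₁ + n) + (i₂ + ℓ₂ + n) + (i₃ + ℓ₃ + n), ?_⟩
  intro m p q hm hpq i ℓ c hr
  have k₁ := hpq.returnAt h₁ (by omega)
  have k₂ := hpq.returnAt h₂ (by omega)
  have k₃ := hpq.returnAt h₃ (by omega)
  obtain ⟨t, t', htt, e1, e2⟩ := h3 _ _ ![p + i₁, p + i₂, p + i₃, i] ![ℓ₁, ℓ₂, ℓ₃, ℓ]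
    ![c₁, c₂, c₃, c] (by
      intro t
      fin_cases t
      · exact k₁
      · exact k₂
      · exact k₃
      · exact hr)
  fin_cases t <;> fin_cases t' <;> simp at htt e1 e2 <;> omega

lemma AtMostThreeReturns.four (h3 : AtMostThreeReturns x) {n : ℕ} {v : ℤ}
    {i₁ i₂ i₃ i₄ ℓ₁ ℓ₂ ℓ₃ ℓ₄ : ℕ} {c₁ c₂ c₃ c₄ : ℤ}
    (h₁ : ReturnAt x n v i₁ ℓ₁ c₁) (h₂ : ReturnAt x n v i₂ ℓ₂ c₂) (h₃ : ReturnAt x n v i₃ ℓ₃ c₃)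
    (h₄ : ReturnAt x n v i₄ ℓ₄ c₄)
    (h₁₂ : ¬ (ℓ₁ = ℓ₂ ∧ c₁ = c₂)) (h₁₃ : ¬ (ℓ₁ = ℓ₃ ∧ c₁ = c₃)) (h₂₃ : ¬ (ℓ₂ = ℓ₃ ∧ c₂ = c₃)) 
    (h₁₄ : ¬ (ℓ₁ = ℓ₄ ∧ c₁ = c₄)) (h₂₄ : ¬ (ℓ₂ = ℓ₄ ∧ c₂ = c₄)) (h₃₄ : ¬ (ℓ₃ = ℓ₄ ∧ c₃ = c₄)) :
    False := by
  obtain ⟨t, t', htt, e1, e2⟩ := h3 n v ![i₁, i₂, i₃, i₄] ![ℓ₁, ℓ₂, ℓ₃, ℓ₄]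
    ![c₁, c₂, c₃, c₄] (by
      intro t
      fin_cases t
      · exact h₁
      · exact h₂
      · exact h₃
      · exact h₄)
  fin_cases t <;> fin_cases t' <;> simp at htt e1 e2 <;> omega

/-- Arbitrarily long prefixes are right special. -/
lemma exists_rightSpecial_prefix (hx : IsBinary x) (hr : FactorsRecur x)
    (hp : NotEventuallyPeriodic x) (M : ℕ) :
    ∃ m p q, M ≤ m ∧ (∀ k < m, x (p + k) = x k ∧ x (q + k) = x k) ∧ x (p + m) = 0 ∧
      x (q + m) = 1 := by
  obtain ⟨T, hT, hT'⟩ := hr 0 M 1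
  have hex : ∃ n, x (n + T) ≠ x n := by
    obtain ⟨n, -, h⟩ := hp 0 T (by omega)
    exact ⟨n, h⟩
  classical
  let m := Nat.find hex
  have hm : x (m + T) ≠ x m := Nat.find_spec hex
  have hlt : ∀ k < m, x (k + T) = x k := fun k hk => by
    have := Nat.find_min hex hk
    simpa using this
  have hM : M ≤ m := by
    by_contra hlt'
    exact hm (by have := hT' m (by omega); rwa [zero_add, add_comm] at this)
  rcases hx m with h0 | h1
  · refine ⟨m, 0, T, hM, fun k hk => ⟨by simp, by rw [add_comm]; exact hlt k hk⟩, by simpa using h0, ?_⟩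
    rw [add_comm]; rcases hx (m + T) with h | h
    · omega
    · exact h
  · refine ⟨m, T, 0, hM, fun k hk => ⟨by rw [add_comm]; exact hlt k hk, by simp⟩, ?_, by simpa using h1⟩
    rw [add_comm]; rcases hx (m + T) with h | h
    · exact h
    · omega

/-- A right special prefix whose extension by `0` occurs before its extension by `1`. -/
lemma exists_rows_zero_one (hx : IsBinary x) (hr : FactorsRecur x)
    (hp : NotEventuallyPeriodic x) (M : ℕ) :
    ∃ m p q, M ≤ m ∧ PrefixRows x m p q ∧ x (p + m) = 0 ∧ x (q + m) = 1 := by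
  obtain ⟨m, p, q, hM, h, h0, h1⟩ := exists_rightSpecial_prefix hx hr hp M
  obtain ⟨q', hq', h'⟩ := hr q (m + 1) (p + 1)
  refine ⟨m, p, q', hM, ⟨by omega, fun k hk => ⟨(h k hk).1, ?_⟩⟩, h0, ?_⟩
  · rw [h' k (by omega)]; exact (h k hk).2
  · rw [h' m (by omega)]; exact h1

end Basic

section Complement

variable {x : ℕ → ℤ}

lemma prefixSum_compl (x : ℕ → ℤ) (i : ℕ) :
    prefixSum (fun k => 1 - x k) i = (i : ℤ) - prefixSum x i := by
  simp [prefixSum, Finset.sum_sub_distrib]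

lemma IsBinary.compl (hx : IsBinary x) : IsBinary fun k => 1 - x k := fun i => by
  have := hx i; dsimp only; omega

lemma FactorsRecur.compl (hr : FactorsRecur x) : FactorsRecur fun k => 1 - x k := fun i n N => by
  obtain ⟨j, hj, h⟩ := hr i n N
  exact ⟨j, hj, fun k hk => by dsimp only; rw [h k hk]⟩

lemma NotEventuallyPeriodic.compl (hp : NotEventuallyPeriodic x) :
    NotEventuallyPeriodic fun k => 1 - x k := fun N T hT => by
  obtain ⟨n, hn, h⟩ := hp N T hT
  exact ⟨n, hn, fun h' => h (by dsimp only at h'; omega)⟩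

lemma ReturnAt.of_compl {n : ℕ} {v : ℤ} {i ℓ : ℕ} {c : ℤ}
    (h : ReturnAt (fun k => 1 - x k) n v i ℓ c) : ReturnAt x n (n - v) i ℓ (ℓ - c) := by
  obtain ⟨h0, h1, h2, h3, h4⟩ := h
  simp only [prefixSum_compl] at h1 h2 h3 h4
  push_cast at h1 h2 h3 h4
  refine ⟨h0, by linarith, by linarith, by linarith, fun k a b h => h4 k a b (by linarith)⟩

lemma AtMostThreeReturns.compl (h3 : AtMostThreeReturns x) :
    AtMostThreeReturns fun k => 1 - x k := fun n v i ℓ c h => by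
  obtain ⟨t, t', htt, e1, e2⟩ := h3 n _ i ℓ _ fun t => (h t).of_compl
  exact ⟨t, t', htt, e1, by omega⟩

lemma IsBalanced.of_compl (h : IsBalanced fun k => 1 - x k) : IsBalanced x := fun n i j => by
  have := h n j i
  simp only [prefixSum_compl] at this
  push_cast at this
  linarith

end Complement

section Letters

variable {x : ℕ → ℤ}

/-- The maximal block of equal letters at the end of a prefix. -/
lemma exists_trailing_block {i m : ℕ} (hi : i + 1 < m) (hne : x i ≠ x (m - 1)) :
    ∃ g, i ≤ g ∧ g + 1 < m ∧ x g ≠ x (m - 1) ∧ ∀ k, g < k → k < m → x k = x (m - 1) := by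
  classical
  let P : ℕ → Prop := fun g => g + 1 < m ∧ x g ≠ x (m - 1)
  have hP : P i := ⟨hi, hne⟩
  have hle : i ≤ m := by omega
  refine ⟨Nat.findGreatest P m, Nat.le_findGreatest hle hP, (Nat.findGreatest_spec hle hP).1,
    (Nat.findGreatest_spec hle hP).2, ?_⟩
  intro k hk hkm
  have := Nat.findGreatest_is_greatest hk hkm.le
  by_contra hne'
  have h1 : k + 1 ≠ m := by rintro rfl; simp at hne'
  exact this ⟨by omega, hne'⟩

lemma exists_next_letter (hx : IsBinary x) (hp : NotEventuallyPeriodic x) (i : ℕ) {a : ℤ}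
    (ha : a = 0 ∨ a = 1) : ∃ t, x (i + t) = a ∧ ∀ k < t, x (i + k) = 1 - a := by
  have hex : ∃ t, x (i + t) = a := by
    by_contra! hne
    obtain ⟨n, hn, h⟩ := hp i 1 one_pos
    have h1 := hne (n - i)
    have h2 := hne (n + 1 - i)
    rw [show i + (n - i) = n by omega] at h1
    rw [show i + (n + 1 - i) = n + 1 by omega] at h2
    have := hx n
    have := hx (n + 1)
    omega
  classical
  refine ⟨Nat.find hex, Nat.find_spec hex, fun k hk => ?_⟩
  have h1 := Nat.find_min hex hk
  have := hx (i + k)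
  omega

end Letters

section Gaps

/-- If consecutive elements of an infinite set of naturals always have the same distance, the set
is an arithmetic progression from any of its elements on. -/
lemma exists_dvd_iff_of_gaps {Q : ℕ → Prop} (hinf : ∀ t, ∃ t', t < t' ∧ Q t')
    (hgap : ∀ t₁ t₁' t₂ t₂', Q t₁ → Q t₁' → t₁ < t₁' → (∀ k, t₁ < k → k < t₁' → ¬ Q k) →
      Q t₂ → Q t₂' → t₂ < t₂' → (∀ k, t₂ < k → k < t₂' → ¬ Q k) → t₁' - t₁ = t₂' - t₂) :
    ∃ c, 0 < c ∧ ∀ t₀ t, Q t₀ → t₀ ≤ t → (Q t ↔ c ∣ t - t₀) := by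
  classical
  have hnext : ∀ t, ∃ t', t < t' ∧ Q t' ∧ ∀ k, t < k → k < t' → ¬ Q k := fun t =>
    ⟨Nat.find (hinf t), (Nat.find_spec (hinf t)).1, (Nat.find_spec (hinf t)).2,
      fun k h1 h2 h3 => Nat.find_min (hinf t) h2 ⟨h1, h3⟩⟩
  obtain ⟨a, -, ha⟩ := hinf 0
  obtain ⟨b, hab, hb, hk⟩ := hnext a
  have step : ∀ t, Q t → Q (t + (b - a)) ∧ ∀ k, t < k → k < t + (b - a) → ¬ Q k := fun t ht => by
    obtain ⟨t', h1, h2, h3⟩ := hnext t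
    have := hgap a b t t' ha hb hab hk ht h2 h1 h3
    rw [show t + (b - a) = t' by omega]
    exact ⟨h2, h3⟩
  refine ⟨b - a, by omega, fun t₀ t ht₀ hle => ?_⟩
  obtain ⟨d, rfl⟩ := Nat.exists_eq_add_of_le hle
  rw [Nat.add_sub_cancel_left]
  clear hle
  induction d using Nat.strong_induction_on generalizing t₀ with
  | _ d ih =>
    obtain ⟨h1, h2⟩ := step t₀ ht₀
    rcases Nat.eq_zero_or_pos d with rfl | hd
    · simpa using ht₀
    by_cases hc : d < b - a
    · refine ⟨fun h => absurd h (h2 _ (by omega) (by omega)), fun h => ?_⟩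
      have := Nat.le_of_dvd hd h
      omega
    · have := ih (d - (b - a)) (by omega) (t₀ + (b - a)) h1
      rw [show t₀ + (b - a) + (d - (b - a)) = t₀ + d by omega] at this
      rw [this]
      obtain ⟨e, rfl⟩ := Nat.exists_eq_add_of_le (not_lt.1 hc)
      rw [Nat.add_sub_cancel_left, Nat.dvd_add_right dvd_rfl]

end Gaps

/-- Every run of zeros preceded by a one has length `r`, and every run of ones preceded by a zero
has length `s` or `s'`. -/
structure Blocks (x : ℕ → ℤ) (r s s' : ℕ) : Prop where
  r_pos : 1 ≤ r
  s_pos : 1 ≤ s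
  s_lt : s < s'
  zero_run : ∀ e, x e = 1 → x (e + 1) = 0 →
    (∀ k, e < k → k ≤ e + r → x k = 0) ∧ x (e + r + 1) = 1
  one_run : ∀ e, x e = 0 → x (e + 1) = 1 → (∀ k, e < k → k ≤ e + s → x k = 1) ∧
    (x (e + s + 1) = 0 ∨ (∀ k, e < k → k ≤ e + s' → x k = 1) ∧ x (e + s' + 1) = 0)

section Marks

variable {x : ℕ → ℤ}

/-- If the windows in a class are those close to a mark, then consecutive marks give returns. -/
lemma returnAt_of_marks {Q : ℕ → Prop} {l : ℕ} {u : ℤ} {o h : ℕ}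
    (hocc : ∀ i, 1 ≤ i → prefixSum x (i + l) - prefixSum x i = u →
      ∃ t, Q t ∧ i ≤ t + o ∧ t + o ≤ i + h)
    (hmark : ∀ i t, Q t → i ≤ t + o → t + o ≤ i + h → prefixSum x (i + l) - prefixSum x i = u)
    {t t' : ℕ} (ht : Q t) (ht' : Q t') (hlt : t + h < t') (hno : ∀ k, t < k → k < t' → ¬ Q k) :
    ReturnAt x l u (t + o) (t' - h - t) (prefixSum x (t + o + (t' - h - t)) - prefixSum x (t + o)) := by
  refine ⟨by omega, hmark _ _ ht (by omega) (by omega), hmark _ _ ht' (by omega) (by omega), rfl, ?_⟩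
  intro k hk1 hk2 hk
  obtain ⟨t₁, h1, h2, h3⟩ := hocc _ (by omega) hk
  exact hno t₁ (by omega) (by omega) h1

end Marks

namespace Blocks

variable {x : ℕ → ℤ} {r s s' : ℕ}

/-- The end of a long right special prefix. -/
lemma trailing (hB : Blocks x r s s') (hx : IsBinary x) {m p q i j : ℕ}
    (hrow : ∀ k < m, x (p + k) = x k ∧ x (q + k) = x k) (hp : x (p + m) = 0) (hq : x (q + m) = 1)
    (hi : x i = 1) (hj : x j = 0) (hij : i < j) (hjm : j < m) :
    ∃ h, i ≤ h ∧ m = h + 1 + r + s ∧ (∀ k, h < k → k ≤ h + r → x k = 0) ∧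
      ∀ k, h + r < k → k ≤ h + r + s → x k = 1 := by
  obtain ⟨r1, s1, ss, Z, O⟩ := hB
  rcases hx (m - 1) with hm | hm
  · obtain ⟨g, g1, g2, g3, g4⟩ := exists_trailing_block (x := x) (i := i) (m := m) (by omega) (by omega)
    have hg : x g = 1 := by have := hx g; omega
    have hrg : m = g + r + 1 := by
      have a1 := Z (p + g) (by rw [(hrow g (by omega)).1]; exact hg)
        (by rw [add_assoc, (hrow (g + 1) (by omega)).1, g4 _ (by omega) (by omega)]; exact hm)
      have a2 := Z (q + g) (by rw [(hrow g (by omega)).2]; exact hg)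
        (by rw [add_assoc, (hrow (g + 1) (by omega)).2, g4 _ (by omega) (by omega)]; exact hm)
      by_contra hne
      rcases Nat.lt_or_gt_of_ne hne with h | h
      · have := a2.1 (q + m) (by omega) (by omega)
        omega
      · have h1 := a1.2
        rw [show p + g + r + 1 = p + (g + r + 1) by omega, (hrow _ (by omega)).1,
          g4 _ (by omega) (by omega)] at h1
        omega
    have a1 := Z (p + g) (by rw [(hrow g (by omega)).1]; exact hg)
        (by rw [add_assoc, (hrow (g + 1) (by omega)).1, g4 _ (by omega) (by omega)]; exact hm)
    have := a1.2
    rw [show p + g + r + 1 = p + m by omega] at this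
    omega
  · have hjm1 : j ≠ m - 1 := by rintro rfl; omega
    obtain ⟨g, g1, g2, g3, g4⟩ := exists_trailing_block (x := x) (i := j) (m := m) (by omega) (by omega)
    have hg : x g = 0 := by have := hx g; omega
    have a1 := O (p + g) (by rw [(hrow g (by omega)).1]; exact hg)
        (by rw [add_assoc, (hrow (g + 1) (by omega)).1, g4 _ (by omega) (by omega)]; exact hm)
    have a2 := O (q + g) (by rw [(hrow g (by omega)).2]; exact hg)
        (by rw [add_assoc, (hrow (g + 1) (by omega)).2, g4 _ (by omega) (by omega)]; exact hm)
    have key : ∀ t, g < t → t < m → x (p + t) = 1 ∧ x (q + t) = 1 := fun t h1 h2 => by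
      rw [(hrow t h2).1, (hrow t h2).2, g4 t h1 h2]; exact ⟨hm, hm⟩
    have hgs : m = g + s + 1 := by
      by_contra hne
      rcases Nat.lt_or_gt_of_ne hne with h | h
      · have := a1.1 (p + m) (by omega) (by omega)
        omega
      · have e1 := (key (g + s + 1) (by omega) (by omega))
        rw [show p + (g + s + 1) = p + g + s + 1 by omega,
          show q + (g + s + 1) = q + g + s + 1 by omega] at e1
        have b1 := a1.2.resolve_left (by omega)
        have b2 := a2.2.resolve_left (by omega)
        rcases lt_trichotomy m (g + s' + 1) with h' | h' | h'
        · have := b1.1 (p + m) (by omega) (by omega)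
          omega
        · have := b2.2
          rw [show q + g + s' + 1 = q + m by omega] at this
          omega
        · have := (key (g + s' + 1) (by omega) (by omega)).1
          rw [show p + (g + s' + 1) = p + g + s' + 1 by omega] at this
          omega
    have hig : i ≠ g := by rintro rfl; omega
    obtain ⟨h, h1, h2, h3, h4⟩ := exists_trailing_block (x := x) (i := i) (m := g + 1) (by omega)
      (by rw [Nat.add_sub_cancel]; omega)
    rw [Nat.add_sub_cancel] at h3 h4
    have hh : x h = 1 := by have := hx h; omega
    obtain ⟨z1, z2⟩ := Z h hh (by rw [h4 _ (by omega) (by omega)]; exact hg)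
    have hgr : g = h + r := by
      have e1 : x (g + 1) = 1 := by rw [g4 _ (by omega) (by omega)]; exact hm
      by_contra hne
      rcases Nat.lt_or_gt_of_ne hne with h' | h'
      · have := z1 (g + 1) (by omega) (by omega)
        omega
      · have := h4 (h + r + 1) (by omega) (by omega)
        omega
    refine ⟨h, h1, by omega, z1, fun k k1 k2 => ?_⟩
    rw [g4 k (by omega) (by omega)]; exact hm

/-- What follows the two extensions of a long right special prefix. -/
lemma rows (hB : Blocks x r s s') (hx : IsBinary x) {m p q i j : ℕ}
    (hrow : ∀ k < m, x (p + k) = x k ∧ x (q + k) = x k) (hp : x (p + m) = 0) (hq : x (q + m) = 1)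
    (hi : x i = 1) (hj : x j = 0) (hij : i < j) (hjm : j < m) :
    i + s < m ∧ (∀ k, m - s ≤ k → k < m → x (p + k) = 1) ∧
      (∀ k, m ≤ k → k < m + r → x (p + k) = 0) ∧
      (∀ k, m - s ≤ k → k < m - s + s' → x (q + k) = 1) ∧
      (∀ k, m - s + s' ≤ k → k < m - s + s' + r → x (q + k) = 0) ∧
      (∀ k, m - s + s' + r ≤ k → k < m - s + s' + r + s → x (q + k) = 1) := by
  obtain ⟨h, h1, h2, h3, h4⟩ := hB.trailing hx hrow hp hq hi hj hij hjm
  obtain ⟨r1, s1, ss, Z, O⟩ := hB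
  have P1 : ∀ k, m - s ≤ k → k < m → x (p + k) = 1 := fun k k1 k2 => by
    rw [(hrow k k2).1]; exact h4 k (by omega) (by omega)
  have P2 : ∀ k, m - s ≤ k → k < m → x (q + k) = 1 := fun k k1 k2 => by
    rw [(hrow k k2).2]; exact h4 k (by omega) (by omega)
  have Zp := (Z (p + (m - 1)) (P1 _ (by omega) (by omega))
    (by rw [show p + (m - 1) + 1 = p + m by omega]; exact hp)).1
  have e0 : x (q + (h + r)) = 0 := by rw [(hrow _ (by omega)).2]; exact h3 _ (by omega) (by omega)
  have Oq := (O _ e0 (P2 (h + r + 1) (by omega) (by omega))).2.resolve_left (by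
    rw [show q + (h + r) + s + 1 = q + m by omega]; omega)
  have Zq := Z (q + (m - s + s' - 1)) (Oq.1 _ (by omega) (by omega))
    (by rw [show q + (m - s + s' - 1) + 1 = q + (h + r) + s' + 1 by omega]; exact Oq.2)
  have Oq' := (O (q + (m - s + s' + r - 1)) (Zq.1 _ (by omega) (by omega))
    (by rw [show q + (m - s + s' + r - 1) + 1 = q + (m - s + s' - 1) + r + 1 by omega]; exact Zq.2)).1
  exact ⟨by omega, P1, fun k k1 k2 => Zp _ (by omega) (by omega), fun k k1 k2 => Oq.1 _ (by omega) (by omega),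
    fun k k1 k2 => Zq.1 _ (by omega) (by omega), fun k k1 k2 => Oq' _ (by omega) (by omega)⟩

lemma not_long_run (hB : Blocks x r s s') (hx : IsBinary x) (hr : FactorsRecur x)
    (hp : NotEventuallyPeriodic x) (i : ℕ) : ¬ ∀ k ≤ s', x (i + k) = 1 := by
  intro h
  obtain ⟨z, hz, -⟩ := exists_next_letter hx hp 0 (a := 0) (Or.inl rfl)
  rw [zero_add] at hz
  obtain ⟨j, hj, hj'⟩ := hr i (s' + 1) (z + 1)
  have hj1 : ∀ k ≤ s', x (j + k) = 1 := fun k hk => by rw [hj' k (by omega)]; exact h k hk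
  have hj0 := hj1 0 (by omega)
  rw [add_zero] at hj0
  obtain ⟨g, g1, g2, g3, g4⟩ := exists_trailing_block (x := x) (i := z) (m := j + 1) (by omega)
    (by rw [Nat.add_sub_cancel]; omega)
  rw [Nat.add_sub_cancel] at g3 g4
  have ones : ∀ k, g < k → k ≤ j + s' → x k = 1 := fun k k1 k2 => by
    by_cases hk : k < j + 1
    · rw [g4 k k1 hk]; exact hj0
    · have := hj1 (k - j) (by omega)
      rwa [show j + (k - j) = k by omega] at this
  have hg : x g = 0 := by have := hx g; omega
  have := hB.s_lt
  rcases (hB.one_run g hg (ones _ (by omega) (by omega))).2 with h' | ⟨-, h'⟩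
  · have := ones (g + s + 1) (by omega) (by omega); omega
  · have := ones (g + s' + 1) (by omega) (by omega); omega

/-- The beginnings of the long runs of ones do not form an arithmetic progression. -/
lemma exists_gaps (hB : Blocks x r s s') (hx : IsBinary x) (hr : FactorsRecur x)
    (hp : NotEventuallyPeriodic x) :
    ∃ Q : ℕ → Prop, (∀ t, Q t ↔ ∀ k < s', x (t + k) = 1) ∧ ∃ t₁ t₁' t₂ t₂',
      Q t₁ ∧ Q t₁' ∧ t₁ < t₁' ∧ (∀ k, t₁ < k → k < t₁' → ¬ Q k) ∧
      Q t₂ ∧ Q t₂' ∧ t₂ < t₂' ∧ (∀ k, t₂ < k → k < t₂' → ¬ Q k) ∧ t₁' - t₁ ≠ t₂' - t₂ := by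
  refine ⟨fun t => ∀ k < s', x (t + k) = 1, fun t => Iff.rfl, ?_⟩
  obtain ⟨i, hi, -⟩ := exists_next_letter hx hp 0 (a := 1) (Or.inr rfl)
  rw [zero_add] at hi
  obtain ⟨j, hj, -⟩ := exists_next_letter hx hp (i + 1) (a := 0) (Or.inl rfl)
  have hs := hB.s_lt
  have hex : ∃ t, ∀ k < s', x (t + k) = 1 := by
    obtain ⟨m, p, q, hm, h, h0, h1⟩ := exists_rows_zero_one hx hr hp (i + 1 + j + 1)
    obtain ⟨e1, -, -, e2, -⟩ := hB.rows hx h.2 h0 h1 hi hj (by omega) (by omega)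
    exact ⟨q + (m - s), fun k hk => by rw [add_assoc]; exact e2 _ (by omega) (by omega)⟩
  obtain ⟨t₀, ht₀⟩ := hex
  by_contra hne
  obtain ⟨c, -, hc⟩ := exists_dvd_iff_of_gaps (Q := fun t => ∀ k < s', x (t + k) = 1)
    (fun t => by
      obtain ⟨t', h1, h2⟩ := hr t₀ s' (t + 1)
      exact ⟨t', by omega, fun k hk => by rw [h2 k hk, ht₀ k hk]⟩)
    (fun t₁ t₁' t₂ t₂' a1 a2 a3 a4 a5 a6 a7 a8 => by
      by_contra h
      exact hne ⟨t₁, t₁', t₂, t₂', a1, a2, a3, a4, a5, a6, a7, a8, h⟩)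
  obtain ⟨m, p, q, hm, h, h0, h1⟩ := exists_rows_zero_one hx hr hp (i + 1 + j + 1 + t₀ + s')
  obtain ⟨e1, -, -, e2, -⟩ := hB.rows hx h.2 h0 h1 hi hj (by omega) (by omega)
  have Qp : ∀ k < s', x (p + t₀ + k) = 1 := fun k hk => by
    rw [add_assoc, (h.2 _ (by omega)).1]; exact ht₀ k hk
  have Qq : ∀ k < s', x (q + t₀ + k) = 1 := fun k hk => by
    rw [add_assoc, (h.2 _ (by omega)).2]; exact ht₀ k hk
  have c1 := (hc (p + t₀) (p + (m - s)) Qp (by omega))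
  have c2 := (hc (q + t₀) (q + (m - s)) Qq (by omega))
  rw [show p + (m - s) - (p + t₀) = m - s - t₀ by omega] at c1
  rw [show q + (m - s) - (q + t₀) = m - s - t₀ by omega] at c2
  have := c1.2 (c2.1 fun k hk => by rw [add_assoc]; exact e2 _ (by omega) (by omega)) s hs
  rw [show p + (m - s) + s = p + m by omega] at this
  omega

lemma after_long_run (hB : Blocks x r s s') (hx : IsBinary x) (hr : FactorsRecur x)
    (hp : NotEventuallyPeriodic x) {t : ℕ} (ht : ∀ k < s', x (t + k) = 1) :
    ∀ k, t + s' ≤ k → k < t + s' + r → x k = 0 := by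
  have hs := hB.s_lt
  have h0 : x (t + s') = 0 := by
    rcases hx (t + s') with h | h
    · exact h
    · exact absurd (fun k hk => by
        rcases Nat.lt_or_eq_of_le hk with h' | rfl
        · exact ht k h'
        · exact h) (hB.not_long_run hx hr hp t)
  intro k h1 h2
  have h3 := ht (s' - 1) (by omega)
  exact (hB.zero_run _ h3 (by rw [show t + (s' - 1) + 1 = t + s' by omega]; exact h0)).1 k
    (by omega) (by omega)

lemma add_lt_of_runs (hB : Blocks x r s s') (hx : IsBinary x) (hr : FactorsRecur x)
    (hp : NotEventuallyPeriodic x) {t t' : ℕ} (ht : ∀ k < s', x (t + k) = 1)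
    (ht' : ∀ k < s', x (t' + k) = 1) (hlt : t < t') : t + s' + r ≤ t' := by
  have hs := hB.s_lt
  have hr1 := hB.r_pos
  have h := hB.after_long_run hx hr hp ht
  by_contra hle
  rcases Nat.lt_or_ge t' (t + s') with h1 | h1
  · have e1 := ht' (t + s' - t') (by omega)
    rw [show t' + (t + s' - t') = t + s' by omega, h _ (by omega) (by omega)] at e1
    omega
  · have e1 := ht' 0 (by omega)
    rw [add_zero, h _ (by omega) (by omega)] at e1
    omega

lemma false_of_class (hB : Blocks x r s s') (hx : IsBinary x) (hr : FactorsRecur x)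
    (hp : NotEventuallyPeriodic x) (h3 : AtMostThreeReturns x) {l : ℕ} {u c₁ c₂ : ℤ}
    {o h i₁ ℓ₂ : ℕ} (h₁ : ReturnAt x l u i₁ 1 c₁)
    (hrows : ∀ M, ∃ m p q i, M ≤ m ∧ PrefixRows x m p q ∧
      ReturnAt x (q - p + l) (prefixSum x q - prefixSum x p + u) i ℓ₂ c₂)
    (hne : ¬ (1 = ℓ₂ ∧ c₁ = c₂)) (hℓ : ℓ₂ + h < s' + r) (hh : h + 1 < s' + r)
    (hocc : ∀ i, 1 ≤ i → prefixSum x (i + l) - prefixSum x i = u →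
      ∃ t, (∀ k < s', x (t + k) = 1) ∧ i ≤ t + o ∧ t + o ≤ i + h)
    (hmark : ∀ i t, (∀ k < s', x (t + k) = 1) → i ≤ t + o → t + o ≤ i + h →
      prefixSum x (i + l) - prefixSum x i = u) : False := by
  obtain ⟨Q, hQ, t₁, t₁', t₂, t₂', a1, a2, a3, a4, a5, a6, a7, a8, a9⟩ := hB.exists_gaps hx hr hp
  have g1 := hB.add_lt_of_runs hx hr hp ((hQ _).1 a1) ((hQ _).1 a2) a3
  have g2 := hB.add_lt_of_runs hx hr hp ((hQ _).1 a5) ((hQ _).1 a6) a7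
  simp only [← hQ] at hocc hmark
  have R1 := returnAt_of_marks hocc hmark a1 a2 (by omega) a4
  have R2 := returnAt_of_marks hocc hmark a5 a6 (by omega) a8
  obtain ⟨M, hM⟩ := h3.restrict h₁ R1 R2 (by omega) (by omega) (by omega)
  obtain ⟨m, p, q, i, hm, h4, h5⟩ := hrows M
  have := hM m p q hm h4 i _ _ h5
  omega

lemma false_of_two_le (hB : Blocks x r s s') (hx : IsBinary x) (hr : FactorsRecur x)
    (hp : NotEventuallyPeriodic x) (h3 : AtMostThreeReturns x) (h2 : 2 ≤ r) : False := by
  have hs := hB.s_lt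
  have hs1 := hB.s_pos
  have hmark : ∀ i t, (∀ k < s', x (t + k) = 1) → i ≤ t + 0 → t + 0 ≤ i + (r - 1) →
      prefixSum x (i + (r - 1 + s')) - prefixSum x i = s' := by
    intro i t ht h4 h5
    have ht0 := ht 0 (by omega)
    have before : ∀ k, i ≤ k → k < t → x k = 0 := by
      intro k k1 k2
      by_contra hk
      have hk1 : x k = 1 := by have := hx k; omega
      obtain ⟨e, he, he'⟩ := exists_next_letter hx hp k (a := 0) (Or.inl rfl)
      have e0 : e ≠ 0 := by rintro rfl; rw [add_zero] at he; omega
      have := hB.zero_run (k + (e - 1)) (by rw [he' _ (by omega)]; rfl)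
        (by rw [show k + (e - 1) + 1 = k + e by omega]; exact he)
      rcases Nat.lt_or_ge t (k + e) with h6 | h6
      · have hQ : x (t - 1) = 1 := by
          have := he' (t - 1 - k) (by omega)
          rw [show k + (t - 1 - k) = t - 1 by omega] at this
          omega
        refine hB.not_long_run hx hr hp (t - 1) fun k' hk' => ?_
        rcases Nat.eq_zero_or_pos k' with rfl | h7
        · exact hQ
        · have := ht (k' - 1) (by omega)
          rwa [show t + (k' - 1) = t - 1 + k' by omega] at this
      · have := this.1 t
        rw [add_zero] at ht0
        by_cases h7 : t ≤ k + (e - 1) + r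
        · have := this (by omega) h7
          omega
        · omega
    have after := hB.after_long_run hx hr hp ht
    have e1 := prefixSum_const (x := x) (a := 0) (i := i) (j := t) (by omega) before
    have e2 := prefixSum_const (x := x) (a := 1) (i := t) (j := t + s') (by omega) (fun k k1 k2 => by
      have := ht (k - t) (by omega)
      rwa [show t + (k - t) = k by omega] at this)
    have e3 := prefixSum_const (x := x) (a := 0) (i := t + s') (j := i + (r - 1 + s')) (by omega)
      (fun k k1 k2 => after k (by omega) (by omega))
    push_cast at e2
    linarith
  have hocc : ∀ i, 1 ≤ i → prefixSum x (i + (r - 1 + s')) - prefixSum x i = s' →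
      ∃ t, (∀ k < s', x (t + k) = 1) ∧ i ≤ t + 0 ∧ t + 0 ≤ i + (r - 1) := by
    intro i _ hi
    obtain ⟨t, ht, ht'⟩ := exists_next_letter hx hp i (a := 1) (Or.inr rfl)
    obtain ⟨g, hg, hg'⟩ := exists_next_letter hx hp (i + t) (a := 0) (Or.inl rfl)
    have e1 := prefixSum_const (x := x) (a := 0) (i := i) (j := i + t) (by omega) (fun k k1 k2 => by
      have := ht' (k - i) (by omega)
      rw [show i + (k - i) = k by omega] at this
      omega)
    have htr : t ≤ r - 1 := by
      by_contra hlt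
      rcases Nat.lt_or_ge (r - 1 + s') t with h4 | h4
      · have := prefixSum_const (x := x) (a := 0) (i := i) (j := i + (r - 1 + s')) (by omega)
          (fun k k1 k2 => by
            have := ht' (k - i) (by omega)
            rw [show i + (k - i) = k by omega] at this
            omega)
        omega
      · have := prefixSum_bounds hx (i := i + t) (j := i + (r - 1 + s')) (by omega)
        push_cast at this
        omega
    refine ⟨i + t, ?_, by omega, by omega⟩
    by_contra hne
    have hgs : g < s' := by
      by_contra hlt
      exact hne fun k hk => by rw [hg' k (by omega)]; rfl
    have hg0 : g ≠ 0 := by rintro rfl; rw [add_zero] at hg; omega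
    have Z := (hB.zero_run (i + t + (g - 1)) (by rw [hg' _ (by omega)]; rfl)
        (by rw [show i + t + (g - 1) + 1 = i + t + g by omega]; exact hg)).1
    have e2 := prefixSum_const (x := x) (a := 1) (i := i + t) (j := i + t + g) (by omega)
      (fun k k1 k2 => by
        have := hg' (k - (i + t)) (by omega)
        rw [show i + t + (k - (i + t)) = k by omega] at this
        omega)
    rcases Nat.lt_or_ge (i + (r - 1 + s')) (i + t + g + r) with h4 | h4
    · have := prefixSum_const (x := x) (a := 0) (i := i + t + g) (j := i + (r - 1 + s')) (by omega)
        (fun k k1 k2 => Z k (by omega) (by omega))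
      push_cast at this e2
      omega
    · have e3 := prefixSum_const (x := x) (a := 0) (i := i + t + g) (j := i + t + g + r) (by omega)
        (fun k k1 k2 => Z k (by omega) (by omega))
      have e4 := prefixSum_bounds hx h4
      push_cast at e2 e3 e4
      omega
  obtain ⟨i, hi, -⟩ := exists_next_letter hx hp 0 (a := 1) (Or.inr rfl)
  rw [zero_add] at hi
  obtain ⟨j, hj, -⟩ := exists_next_letter hx hp (i + 1) (a := 0) (Or.inl rfl)
  obtain ⟨Q, hQ, -, t, -, -, -, ht, hlt, -⟩ := hB.exists_gaps hx hr hp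
  obtain ⟨t', ht1, ht2⟩ := hr t s' r
  have hrun : ∀ k < s', x (t' + k) = 1 := fun k hk => by rw [ht2 k hk, (hQ t).1 ht k hk]
  refine hB.false_of_class hx hr hp h3 (l := r - 1 + s') (u := s') (o := 0) (h := r - 1)
    (i₁ := t' - (r - 1)) (c₁ := prefixSum x (t' - (r - 1) + 1) - prefixSum x (t' - (r - 1)))
    (ℓ₂ := s + 1) (c₂ := s)
    ⟨one_pos, hmark _ t' hrun (by omega) (by omega), hmark _ t' hrun (by omega) (by omega), rfl,
      fun k _ _ => by omega⟩ (fun M => ?_) (by omega) (by omega) (by omega) hocc hmark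
  obtain ⟨m, p, q, hm, h, h0, h1⟩ := exists_rows_zero_one hx hr hp (M + i + 1 + j + 1)
  obtain ⟨e1, e2, e3, e4, e5, e6⟩ := hB.rows hx h.2 h0 h1 hi hj (by omega) (by omega)
  obtain ⟨S1, S2⟩ := h.prefixSum (k := m - s) (by omega)
  have A : ∀ k ≤ s, prefixSum x (p + (m - s) + k) = prefixSum x (p + (m - s)) + k := fun k hk => by
    rw [prefixSum_const (x := x) (a := 1) (i := p + (m - s)) (by omega) fun k' k1 k2 => by
      have := e2 (k' - p) (by omega) (by omega)
      rwa [show p + (k' - p) = k' by omega] at this]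
    push_cast; ring
  have A' := prefixSum_const (x := x) (a := 0) (i := p + (m - s) + s) (j := p + (m - s) + (s + 1))
    (by omega) fun k' k1 k2 => by
      have := e3 (k' - p) (by omega) (by omega)
      rwa [show p + (k' - p) = k' by omega] at this
  have B : prefixSum x (q + (m - s + s')) = prefixSum x (q + (m - s)) + s' := by
    rw [prefixSum_const (x := x) (a := 1) (i := q + (m - s)) (by omega) fun k' k1 k2 => by
      have := e4 (k' - q) (by omega) (by omega)
      rwa [show q + (k' - q) = k' by omega] at this]
    push_cast; ring
  have C : ∀ k ≤ r, prefixSum x (q + (m - s + s') + k) = prefixSum x (q + (m - s + s')) := fun k hk => by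
    rw [prefixSum_const (x := x) (a := 0) (i := q + (m - s + s')) (by omega) fun k' k1 k2 => by
      have := e5 (k' - q) (by omega) (by omega)
      rwa [show q + (k' - q) = k' by omega] at this]
    push_cast; ring
  have D : ∀ k ≤ s, prefixSum x (q + (m - s + s' + r) + k) = prefixSum x (q + (m - s + s') + r) + k :=
    fun k hk => by
      rw [show q + (m - s + s') + r = q + (m - s + s' + r) by omega,
        prefixSum_const (x := x) (a := 1) (i := q + (m - s + s' + r)) (by omega) fun k' k1 k2 => by
          have := e6 (k' - q) (by omega) (by omega)
          rwa [show q + (k' - q) = k' by omega] at this]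
      push_cast; ring
  have hpq := h.1
  refine ⟨m, p, q, p + (m - s), by omega, h, by omega, ?_, ?_, ?_, ?_⟩
  · have := C (r - 1) (by omega)
    rw [show p + (m - s) + (q - p + (r - 1 + s')) = q + (m - s + s') + (r - 1) by omega]
    linarith
  · have c1 := C r le_rfl
    have d1 := D s le_rfl
    have a1 := A s le_rfl
    rw [show p + (m - s) + (s + 1) + (q - p + (r - 1 + s')) = q + (m - s + s' + r) + s by omega]
    linarith
  · have a1 := A s le_rfl
    linarith
  · intro k k1 k2 k3
    have c1 := C r le_rfl
    have d1 := D (k - 1) (by omega)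
    have a1 := A k (by omega)
    rw [show p + (m - s) + k + (q - p + (r - 1 + s')) = q + (m - s + s' + r) + (k - 1) by omega] at k3
    push_cast [Nat.cast_sub k1] at d1
    linarith

lemma false_of_one (hB : Blocks x 1 s s') (hx : IsBinary x) (hr : FactorsRecur x)
    (hp : NotEventuallyPeriodic x) (h3 : AtMostThreeReturns x) (h2 : s + 2 ≤ s') : False := by
  have hs1 := hB.s_pos
  have hmark : ∀ i t, (∀ k < s', x (t + k) = 1) → i ≤ t + 1 → t + 1 ≤ i + 1 →
      prefixSum x (i + (s' - 1)) - prefixSum x i = s' - 1 := by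
    intro i t ht h4 h5
    rw [prefixSum_const (x := x) (a := 1) (i := i) (by omega) fun k k1 k2 => by
      have := ht (k - t) (by omega)
      rwa [show t + (k - t) = k by omega] at this]
    push_cast [Nat.cast_sub (show 1 ≤ s' by omega)]; ring
  have hocc : ∀ i, 1 ≤ i → prefixSum x (i + (s' - 1)) - prefixSum x i = s' - 1 →
      ∃ t, (∀ k < s', x (t + k) = 1) ∧ i ≤ t + 1 ∧ t + 1 ≤ i + 1 := by
    intro i hi1 hi
    have ones : ∀ k < s' - 1, x (i + k) = 1 := by
      intro k hk
      rcases hx (i + k) with h | h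
      · have b1 := prefixSum_bounds hx (i := i) (j := i + k) (by omega)
        have b2 := prefixSum_bounds hx (i := i + k + 1) (j := i + (s' - 1)) (by omega)
        rw [prefixSum_succ, h] at b2
        push_cast [Nat.cast_sub (show 1 ≤ s' by omega)] at b1 b2
        linarith
      · exact h
    rcases hx (i + (s' - 1)) with h | h
    · refine ⟨i - 1, ?_, by omega, by omega⟩
      have h1 : x (i - 1) = 1 := by
        by_contra hne
        have h0 : x (i - 1) = 0 := by have := hx (i - 1); omega
        have o0 := ones 0 (by omega)
        rw [add_zero] at o0
        rcases (hB.one_run (i - 1) h0 (by rw [Nat.sub_add_cancel hi1]; exact o0)).2 with h' | ⟨h', -⟩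
        · have := ones s (by omega)
          rw [show i + s = i - 1 + s + 1 by omega] at this
          omega
        · have := h' (i + (s' - 1)) (by omega) (by omega)
          omega
      intro k hk
      rcases Nat.eq_zero_or_pos k with rfl | hk0
      · exact h1
      · have := ones (k - 1) (by omega)
        rwa [show i + (k - 1) = i - 1 + k by omega] at this
    · refine ⟨i, fun k hk => ?_, by omega, by omega⟩
      rcases Nat.lt_or_ge k (s' - 1) with h' | h'
      · exact ones k h'
      · rwa [show k = s' - 1 by omega]
  obtain ⟨i, hi, -⟩ := exists_next_letter hx hp 0 (a := 1) (Or.inr rfl)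
  rw [zero_add] at hi
  obtain ⟨j, hj, -⟩ := exists_next_letter hx hp (i + 1) (a := 0) (Or.inl rfl)
  obtain ⟨Q, hQ, -, t, -, -, -, ht, hlt, -⟩ := hB.exists_gaps hx hr hp
  rw [hQ] at ht
  have ht0 := ht 0 (by omega)
  rw [add_zero] at ht0
  refine hB.false_of_class hx hr hp h3 (l := s' - 1) (u := s' - 1) (o := 1) (h := 1)
    (i₁ := t) (c₁ := 1) (ℓ₂ := s) (c₂ := s - 1)
    ⟨one_pos, hmark _ t ht (by omega) (by omega), hmark _ t ht (by omega) (by omega),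
      by rw [prefixSum_succ, ht0]; ring,
      fun k _ _ => by omega⟩ (fun M => ?_) (by omega) (by omega) (by omega) hocc hmark
  obtain ⟨m, p, q, hm, h, h0, h1⟩ := exists_rows_zero_one hx hr hp (M + i + 1 + j + 1)
  obtain ⟨e1, e2, e3, e4, e5, e6⟩ := hB.rows hx h.2 h0 h1 hi hj (by omega) (by omega)
  obtain ⟨S1, S2⟩ := h.prefixSum (k := m - s) (by omega)
  have A : ∀ k ≤ s, prefixSum x (p + (m - s) + k) = prefixSum x (p + (m - s)) + k := fun k hk => by
    rw [prefixSum_const (x := x) (a := 1) (i := p + (m - s)) (by omega) fun k' k1 k2 => by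
      have := e2 (k' - p) (by omega) (by omega)
      rwa [show p + (k' - p) = k' by omega] at this]
    push_cast; ring
  have A' := prefixSum_const (x := x) (a := 0) (i := p + (m - s) + s) (j := p + (m - s) + (s + 1))
    (by omega) fun k' k1 k2 => by
      have := e3 (k' - p) (by omega) (by omega)
      rwa [show p + (k' - p) = k' by omega] at this
  have B : prefixSum x (q + (m - s + s')) = prefixSum x (q + (m - s)) + s' := by
    rw [prefixSum_const (x := x) (a := 1) (i := q + (m - s)) (by omega) fun k' k1 k2 => by
      have := e4 (k' - q) (by omega) (by omega)
      rwa [show q + (k' - q) = k' by omega] at this]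
    push_cast; ring
  have C : prefixSum x (q + (m - s + s') + 1) = prefixSum x (q + (m - s + s')) := by
    rw [prefixSum_succ, e5 _ le_rfl (by omega), add_zero]
  have D : ∀ k ≤ s, prefixSum x (q + (m - s + s' + 1) + k) = prefixSum x (q + (m - s + s') + 1) + k :=
    fun k hk => by
      rw [show q + (m - s + s') + 1 = q + (m - s + s' + 1) by omega,
        prefixSum_const (x := x) (a := 1) (i := q + (m - s + s' + 1)) (by omega) fun k' k1 k2 => by
          have := e6 (k' - q) (by omega) (by omega)
          rwa [show q + (k' - q) = k' by omega] at this]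
      push_cast; ring
  have hpq := h.1
  have a0 := A 1 (by omega)
  push_cast at a0
  refine ⟨m, p, q, p + (m - s) + 1, by omega, h, by omega, ?_, ?_, ?_, ?_⟩
  · rw [show p + (m - s) + 1 + (q - p + (s' - 1)) = q + (m - s + s') by omega]
    linarith
  · have d1 := D (s - 1) (by omega)
    have a1 := A s le_rfl
    rw [show p + (m - s) + 1 + s + (q - p + (s' - 1)) = q + (m - s + s' + 1) + (s - 1) by omega,
      show p + (m - s) + 1 + s = p + (m - s) + (s + 1) by omega]
    push_cast [Nat.cast_sub hs1] at d1 A'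
    linarith
  · have a1 := A s le_rfl
    rw [show p + (m - s) + 1 + s = p + (m - s) + (s + 1) by omega]
    push_cast at A'
    linarith
  · intro k k1 k2 k3
    have d1 := D (k - 1) (by omega)
    have a1 := A (k + 1) (by omega)
    rw [show p + (m - s) + 1 + k + (q - p + (s' - 1)) = q + (m - s + s' + 1) + (k - 1) by omega,
      show p + (m - s) + 1 + k = p + (m - s) + (k + 1) by omega] at k3
    push_cast [Nat.cast_sub k1] at d1 a1
    linarith

end Blocks

/-- The letters at `e + 1, …, e + t` form a maximal block of letters `y`. -/
structure RunAt (x : ℕ → ℤ) (y : ℤ) (e t : ℕ) : Prop where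
  pos : 1 ≤ t
  left : x e = 1 - y
  mid : ∀ k, e < k → k ≤ e + t → x k = y
  right : x (e + t + 1) = 1 - y

section Runs

variable {x : ℕ → ℤ}

lemma exists_runAt (hx : IsBinary x) (hp : NotEventuallyPeriodic x) {y : ℤ} (hy : y = 0 ∨ y = 1)
    {e : ℕ} (h0 : x e = 1 - y) (h1 : x (e + 1) = y) : ∃ t, RunAt x y e t := by
  obtain ⟨t, ht, ht'⟩ := exists_next_letter hx hp (e + 1) (a := 1 - y) (by omega)
  have t0 : t ≠ 0 := by rintro rfl; rw [add_zero] at ht; omega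
  refine ⟨t, by omega, h0, fun k k1 k2 => ?_, by rw [← ht]; congr 1; omega⟩
  have := ht' (k - (e + 1)) (by omega)
  rw [show e + 1 + (k - (e + 1)) = k by omega] at this
  omega

lemma RunAt.compl {y : ℤ} {e t : ℕ} (h : RunAt x y e t) : RunAt (fun k => 1 - x k) (1 - y) e t :=
  ⟨h.pos, by have := h.left; omega, fun k k1 k2 => by rw [h.mid k k1 k2],
    by have := h.right; omega⟩

lemma RunAt.of_compl {y : ℤ} {e t : ℕ} (h : RunAt (fun k => 1 - x k) y e t) :
    RunAt x (1 - y) e t := by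
  have := h.compl
  simpa using this

lemma RunAt.exists_ge (hr : FactorsRecur x) {y : ℤ} {e t : ℕ} (h : RunAt x y e t) (N : ℕ) :
    ∃ e', N ≤ e' ∧ RunAt x y e' t := by
  obtain ⟨j, hj, hj'⟩ := hr e (t + 2) N
  refine ⟨j, hj, h.pos, ?_, fun k k1 k2 => ?_, ?_⟩
  · have := hj' 0 (by omega)
    rw [add_zero, add_zero] at this; rw [this]; exact h.left
  · have := hj' (k - j) (by omega)
    rw [show j + (k - j) = k by omega] at this
    rw [this]; exact h.mid _ (by omega) (by omega)
  · rw [add_assoc, hj' _ (by omega), ← add_assoc]; exact h.right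

lemma RunAt.eq_of_last {y : ℤ} {e t c : ℕ} (h : RunAt x y e t)
    (hmid : ∀ k, e < k → k ≤ e + c → x k = y) (hend : x (e + c + 1) = 1 - y) : t = c := by
  have h1 := h.mid (e + c + 1)
  have h2 := hmid (e + t + 1)
  have h3 := h.right
  by_contra hne
  rcases Nat.lt_or_gt_of_ne hne with h' | h'
  · have := h2 (by omega) (by omega); omega
  · have := h1 (by omega) (by omega); omega

lemma RunAt.sum {y : ℤ} {e t : ℕ} (h : RunAt x y e t) {k : ℕ} (hk : k ≤ t) :
    prefixSum x (e + 1 + k) = prefixSum x e + (1 - y) + y * k := by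
  rw [prefixSum_const (x := x) (a := y) (i := e + 1) (by omega) fun k k1 k2 => h.mid k (by omega) (by omega),
    prefixSum_succ, h.left]
  push_cast; ring

lemma RunAt.sum_right {y : ℤ} {e t : ℕ} (h : RunAt x y e t) :
    prefixSum x (e + t + 2) = prefixSum x e + (1 - y) + y * t + (1 - y) := by
  rw [prefixSum_succ x (e + t + 1), h.right, show e + t + 1 = e + 1 + t by omega, h.sum le_rfl]

lemma exists_returnAt (hr : FactorsRecur x) {n : ℕ} {v : ℤ} {i : ℕ}
    (h : prefixSum x (i + n) - prefixSum x i = v) : ∃ ℓ c, ReturnAt x n v i ℓ c := by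
  have hex : ∃ ℓ, 0 < ℓ ∧ prefixSum x (i + ℓ + n) - prefixSum x (i + ℓ) = v := by
    obtain ⟨j, hj, hj'⟩ := hr i n (i + 1)
    refine ⟨j - i, by omega, ?_⟩
    rw [show i + (j - i) = j by omega, prefixSum_shift hj' le_rfl, h]
  classical
  exact ⟨Nat.find hex, _, (Nat.find_spec hex).1, h, (Nat.find_spec hex).2, rfl,
    fun k k1 k2 k3 => Nat.find_min hex k2 ⟨k1, k3⟩⟩

/-- A block of ones gives a return to a single zero. -/
lemma RunAt.returnAt_zero {e t : ℕ} (h : RunAt x 1 e t) : ReturnAt x 1 0 e (t + 1) t := by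
  have hl := h.left
  have hr := h.right
  refine ⟨by omega, ?_, ?_, ?_, fun k k1 k2 => ?_⟩
  · rw [prefixSum_succ, hl]; ring
  · rw [prefixSum_succ, ← add_assoc, hr]; ring
  · rw [show e + (t + 1) = e + 1 + t by omega, h.sum le_rfl]; ring
  · rw [prefixSum_succ, h.mid _ (by omega) (by omega)]; simp

lemma RunAt.returnAt_one {e t : ℕ} (h : RunAt x 0 e t) : ReturnAt x 1 1 e (t + 1) 1 := by
  have := h.compl.returnAt_zero.of_compl
  simpa using this

lemma RunAt.returnAt_pair_zero {e t : ℕ} (h : RunAt x 0 e t) : ReturnAt x 2 1 e t 1 := by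
  have hp := h.pos
  refine ⟨by omega, ?_, ?_, ?_, fun k k1 k2 => ?_⟩
  · have := h.sum hp
    rw [show e + 2 = e + 1 + 1 by omega, this]; ring
  · have h1 := h.sum (k := t - 1) (by omega)
    rw [h.sum_right, show e + t = e + 1 + (t - 1) by omega, h1]; ring
  · have h1 := h.sum (k := t - 1) (by omega)
    rw [show e + t = e + 1 + (t - 1) by omega, h1]; ring
  · have h1 := h.sum (k := k - 1) (by omega)
    have h2 := h.sum (k := k + 1) (by omega)
    rw [show e + k + 2 = e + 1 + (k + 1) by omega, show e + k = e + 1 + (k - 1) by omega, h1, h2]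
    simp

lemma RunAt.returnAt_pair_one {e t : ℕ} (h : RunAt x 1 e t) : ReturnAt x 2 1 e t (t - 1) := by
  have := h.compl
  rw [sub_self] at this
  have := this.returnAt_pair_zero.of_compl
  simpa using this

/-- With `00` a factor, at most two lengths of blocks of ones occur. -/
lemma AtMostThreeReturns.runs (h3 : AtMostThreeReturns x) {i : ℕ} (h0 : x i = 0)
    (h1 : x (i + 1) = 0) {e₁ e₂ e₃ t₁ t₂ t₃ : ℕ} (r₁ : RunAt x 1 e₁ t₁) (r₂ : RunAt x 1 e₂ t₂)
    (r₃ : RunAt x 1 e₃ t₃) : t₁ = t₂ ∨ t₁ = t₃ ∨ t₂ = t₃ := by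
  have R : ReturnAt x 1 0 i 1 0 := ⟨one_pos, by rw [prefixSum_succ, h0]; ring,
    by rw [prefixSum_succ, h1]; ring, by rw [prefixSum_succ, h0]; ring, fun k _ _ => by omega⟩
  have p1 := r₁.pos
  have p2 := r₂.pos
  have p3 := r₃.pos
  by_contra hne
  exact h3.four R r₁.returnAt_zero r₂.returnAt_zero r₃.returnAt_zero (by omega) (by omega) (by omega)
    (by omega) (by omega) (by omega)

end Runs

section TwoTwo

variable {x : ℕ → ℤ}

/-- The continuation of a right special prefix ending in zeros. -/
lemma exists_rows_trailing_zero (hx : IsBinary x) (hr : FactorsRecur x) (hp : NotEventuallyPeriodic x)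
    {r₁ r₂ : ℕ} (hR : ∀ e t, RunAt x 0 e t → t = r₁ ∨ t = r₂) (hlt : r₁ < r₂)
    (hrows : ∀ M, ∃ m p q, M ≤ m ∧ (∀ k < m, x (p + k) = x k ∧ x (q + k) = x k) ∧
      x (p + m) = 0 ∧ x (q + m) = 1 ∧ x (m - 1) = 0) (M : ℕ) :
    ∃ m p q, M + r₁ + 1 ≤ m ∧ PrefixRows x m p q ∧ (∀ k, m - r₁ ≤ k → k < m → x k = 0) ∧
      (∀ k, m ≤ k → k < m + (r₂ - r₁) → x (p + k) = 0) ∧ x (q + m) = 1 := by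
  obtain ⟨i, hi, -⟩ := exists_next_letter hx hp 0 (a := 1) (Or.inr rfl)
  rw [zero_add] at hi
  obtain ⟨m, p, q, hm, h, h0, h1, hm0⟩ := hrows (M + r₁ + 1 + i + 2)
  obtain ⟨g, g1, g2, g3, g4⟩ := exists_trailing_block (x := x) (i := i) (m := m) (by omega) (by omega)
  rw [hm0] at g3 g4
  have hg : x g = 1 := by have := hx g; omega
  have zq : ∀ k, g < k → k < m → x (q + k) = 0 := fun k k1 k2 => by
    rw [(h k k2).2]; exact g4 k k1 k2
  have zp : ∀ k, g < k → k ≤ m → x (p + k) = 0 := fun k k1 k2 => by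
    rcases Nat.lt_or_eq_of_le k2 with h' | rfl
    · rw [(h k h').1]; exact g4 k k1 h'
    · exact h0
  have Rq : RunAt x 0 (q + g) (m - 1 - g) := ⟨by omega, by rw [(h g (by omega)).2, hg]; rfl,
    fun k k1 k2 => by
      have := zq (k - q) (by omega) (by omega)
      rwa [show q + (k - q) = k by omega] at this,
    by rw [show q + g + (m - 1 - g) + 1 = q + m by omega, h1]; rfl⟩
  obtain ⟨t, Rp⟩ := exists_runAt hx hp (e := p + g) (Or.inl rfl) (by rw [(h g (by omega)).1, hg]; rfl)
    (zp (g + 1) (by omega) (by omega))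
  have ht : m - 1 - g < t := by
    by_contra hle
    have e1 := zp (g + t + 1) (by omega) (by omega)
    have e2 := Rp.right
    rw [show p + (g + t + 1) = p + g + t + 1 by omega] at e1
    omega
  have a1 := hR _ _ Rq
  have a2 := hR _ _ Rp
  obtain ⟨q', hq', h'⟩ := hr q (m + 1) (p + 1)
  refine ⟨m, p, q', by omega, ⟨by omega, fun k hk => ⟨(h k hk).1, ?_⟩⟩,
    fun k k1 k2 => g4 k (by omega) k2, fun k k1 k2 => Rp.mid _ (by omega) (by omega), ?_⟩
  · rw [h' k (by omega)]; exact (h k hk).2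
  · rw [h' m (by omega)]; exact h1

lemma false_of_two_two (hx : IsBinary x) (hr : FactorsRecur x) (hp : NotEventuallyPeriodic x)
    (h3 : AtMostThreeReturns x) {i : ℕ} (hi : x i = 1) (hi' : x (i + 1) = 1)
    {r₁ r₂ s₁ s₂ e₁ e₂ f₁ f₂ : ℕ} (hR : ∀ e t, RunAt x 0 e t → t = r₁ ∨ t = r₂) (hr12 : r₁ < r₂)
    (hS : ∀ e t, RunAt x 1 e t → t = s₁ ∨ t = s₂) (hs12 : s₁ < s₂)
    (E₁ : RunAt x 0 e₁ r₁) (E₂ : RunAt x 0 e₂ r₂) (F₁ : RunAt x 1 f₁ s₁) (F₂ : RunAt x 1 f₂ s₂)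
    (hrows : ∀ M, ∃ m p q, M ≤ m ∧ (∀ k < m, x (p + k) = x k ∧ x (q + k) = x k) ∧
      x (p + m) = 0 ∧ x (q + m) = 1 ∧ x (m - 1) = 0) : False := by
  have r1 := E₁.pos
  have s1 := F₁.pos
  have B : ReturnAt x 1 1 i 1 1 := ⟨one_pos, by rw [prefixSum_succ, hi]; ring,
    by rw [prefixSum_succ, hi']; ring, by rw [prefixSum_succ, hi]; ring, fun k _ _ => by omega⟩
  obtain ⟨M₁, hM₁⟩ := h3.restrict B E₁.returnAt_one E₂.returnAt_one (by omega) (by omega) (by omega)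
  have rows : ∀ M, ∃ m p q, M + r₁ + 1 ≤ m ∧ PrefixRows x m p q ∧ (∀ k, m - r₁ ≤ k → k < m → x k = 0) ∧
      (∀ k, m ≤ k → k < m + (r₂ - r₁) → x (p + k) = 0) ∧ x (q + m) = 1 ∧ x (q + m + 1) = 1 := by
    intro M
    obtain ⟨m, p, q, hm, h, ht, hL, hU⟩ := exists_rows_trailing_zero hx hr hp hR hr12 hrows (M + M₁)
    refine ⟨m, p, q, by omega, h, ht, hL, hU, ?_⟩
    rcases hx (q + m + 1) with h0 | h0
    swap
    · exact h0
    exfalso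
    have hpq := h.1
    obtain ⟨S1, S2⟩ := h.prefixSum (k := m) le_rfl
    have l0 := hL m le_rfl (by omega)
    have := hM₁ m p q (by omega) h (p + m) 1 0 ⟨one_pos, by
        rw [show p + m + (q - p + 1) = q + m + 1 by omega, prefixSum_succ, hU]; linarith, by
        rw [show p + m + 1 + (q - p + 1) = q + m + 1 + 1 by omega, prefixSum_succ, prefixSum_succ,
          prefixSum_succ, hU, h0, l0]; linarith, by rw [prefixSum_succ, l0]; ring,
        fun k _ _ => by omega⟩
    omega
  have G₁ := E₁.returnAt_pair_zero
  have G₂ := E₂.returnAt_pair_zero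
  have H₁ := F₁.returnAt_pair_one
  have H₂ := F₂.returnAt_pair_one
  have two : (r₁ = 2 ∨ r₂ = 2) ∧ (s₁ = 2 ∨ s₂ = 2) := by
    by_contra hne
    exact h3.four G₁ G₂ H₁ H₂ (by omega) (by omega) (by omega) (by omega) (by omega) (by omega)
  rcases two.1 with hr2 | hr2
  · subst hr2
    obtain ⟨e, he, E⟩ := E₁.exists_ge hr 1
    have tri : ∃ (n : ℕ) (j ℓ : ℕ) (c : ℤ), ReturnAt x 3 1 j ℓ c ∧ ReturnAt x 3 1 n 3 1 ∧
        (ℓ = 1 ∧ c = 0 ∨ 4 ≤ ℓ ∧ c = ℓ - 2) := by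
      have key : ∀ f s, RunAt x 1 f s → ∃ j, s = 1 ∧ ReturnAt x 3 1 j 1 0 ∨
          2 ≤ s ∧ ReturnAt x 3 1 j (s + 1) (s - 1) := by
        intro f s F
        obtain ⟨f', hf', F⟩ := F.exists_ge hr (e₁ + 3)
        have sp := F.pos
        have fl := F.left
        rw [sub_self] at fl
        have fr := F.right
        rw [sub_self] at fr
        have z0 : x (f' - 1) = 0 := by
          by_contra hne
          have h1 : x (f' - 1) = 1 - 0 := by have := hx (f' - 1); omega
          obtain ⟨t, ht⟩ := exists_runAt hx hp (e := f' - 1) (Or.inl rfl) h1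
            (by rw [show f' - 1 + 1 = f' by omega]; exact fl)
          have := ht.eq_of_last (c := 1) (fun k k1 k2 => by rw [show k = f' by omega]; exact fl)
            (by rw [show f' - 1 + 1 + 1 = f' + 1 by omega, F.mid _ (by omega) (by omega)]; rfl)
          have := hR _ _ ht
          omega
        have z1 : x (f' + s + 2) = 0 := by
          by_contra hne
          have h1 : x (f' + s + 2) = 1 := by have := hx (f' + s + 2); omega
          have h2 := F.mid (f' + s) (by omega) (by omega)
          obtain ⟨t, ht⟩ := exists_runAt hx hp (e := f' + s) (Or.inl rfl) (by rw [h2]; rfl) fr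
          have := ht.eq_of_last (c := 1) (fun k k1 k2 => by rw [show k = f' + s + 1 by omega]; exact fr)
            (by rw [h1]; rfl)
          have := hR _ _ ht
          omega
        have T0 := prefixSum_step x (show f' = f' - 1 + 1 by omega)
        have T1 := F.sum_right
        have T2 := prefixSum_succ x (f' + s + 2)
        rw [z0] at T0
        rw [z1] at T2
        refine ⟨f' - 1, ?_⟩
        rcases Nat.lt_or_ge s 2 with hs | hs
        · obtain rfl : s = 1 := by omega
          refine Or.inl ⟨rfl, one_pos, ?_, ?_, by rw [show f' - 1 + 1 = f' by omega]; linarith,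
            fun k _ _ => by omega⟩
          · have := F.sum (k := 1) le_rfl
            rw [show f' - 1 + 3 = f' + 1 + 1 by omega, this]
            push_cast; linarith
          · rw [show f' - 1 + 1 + 3 = f' + 1 + 2 by omega, T1, show f' - 1 + 1 = f' by omega]
            push_cast; ring
        · refine Or.inr ⟨hs, by omega, ?_, ?_, ?_, fun k k1 k2 => ?_⟩
          · have := F.sum (k := 1) (by omega)
            rw [show f' - 1 + 3 = f' + 1 + 1 by omega, this]
            push_cast; linarith
          · have := F.sum (k := s - 1) (by omega)
            rw [show f' - 1 + (s + 1) + 3 = f' + s + 2 + 1 by omega, T2, T1,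
              show f' - 1 + (s + 1) = f' + 1 + (s - 1) by omega, this]
            push_cast [Nat.cast_sub sp]; ring
          · have := F.sum (k := s - 1) (by omega)
            rw [show f' - 1 + (s + 1) = f' + 1 + (s - 1) by omega, this]
            push_cast [Nat.cast_sub sp]; linarith
          · rcases Nat.lt_or_ge k s with h' | h'
            · have t1 := F.sum (k := k + 1) (by omega)
              rw [show f' - 1 + k + 3 = f' + 1 + (k + 1) by omega, t1]
              rcases Nat.lt_or_ge k 2 with h'' | h''
              · obtain rfl : k = 1 := by omega
                rw [show f' - 1 + 1 = f' by omega]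
                push_cast; omega
              · have t2 := F.sum (k := k - 2) (by omega)
                rw [show f' - 1 + k = f' + 1 + (k - 2) by omega, t2]
                push_cast [Nat.cast_sub h'']; omega
            · have t2 := F.sum (k := s - 2) (by omega)
              rw [show f' - 1 + k + 3 = f' + s + 2 by omega, T1,
                show f' - 1 + k = f' + 1 + (s - 2) by omega, t2]
              push_cast [Nat.cast_sub hs]; omega
      obtain ⟨j₁, k₁⟩ := key _ _ F₁
      obtain ⟨j₂, k₂⟩ := key _ _ F₂
      rcases two.2 with rfl | rfl
      · rcases k₁ with k₁ | k₁
        · omega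
        rcases k₂ with k₂ | k₂
        · omega
        exact ⟨j₁, j₂, _, _, k₂.2, by simpa using k₁.2, Or.inr ⟨by omega, by push_cast; ring⟩⟩
      · rcases k₂ with k₂ | k₂
        · omega
        rcases k₁ with k₁ | k₁
        · exact ⟨j₂, j₁, _, _, k₁.2, by simpa using k₂.2, Or.inl ⟨rfl, rfl⟩⟩
        · omega
    obtain ⟨n, j, ℓ, c, U₁, U₂, hU⟩ := tri
    have run3 : ∀ e r, 2 ≤ r → RunAt x 0 e r → ReturnAt x 3 1 e (r - 1) 1 := by
      intro e r h2 E
      refine ⟨by omega, ?_, ?_, ?_, fun k k1 k2 => ?_⟩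
      · have := E.sum (k := 2) h2
        rw [show e + 3 = e + 1 + 2 by omega, this]; ring
      · have := E.sum (k := r - 2) (by omega)
        rw [show e + (r - 1) + 3 = e + r + 2 by omega, E.sum_right,
          show e + (r - 1) = e + 1 + (r - 2) by omega, this]; ring
      · have := E.sum (k := r - 2) (by omega)
        rw [show e + (r - 1) = e + 1 + (r - 2) by omega, this]; ring
      · have t1 := E.sum (k := k + 2) (by omega)
        have t2 := E.sum (k := k - 1) (by omega)
        rw [show e + k + 3 = e + 1 + (k + 2) by omega, t1, show e + k = e + 1 + (k - 1) by omega, t2]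
        simp
    have K₁ := run3 _ _ le_rfl E₁
    have K₂ := run3 _ _ (by omega) E₂
    have hr4 : r₂ = 4 := by
      by_contra hne
      exact h3.four K₁ K₂ U₁ U₂ (by omega) (by omega) (by omega) (by omega) (by omega) (by omega)
    subst hr4
    obtain ⟨M, hM⟩ := h3.restrict K₁ U₁ U₂ (by omega) (by omega) (by omega)
    obtain ⟨m, p, q, hm, h, ht, hL, hU0, hU1⟩ := rows M
    have hpq := h.1
    obtain ⟨S1, -⟩ := h.prefixSum (k := m - 2) (by omega)
    obtain ⟨-, S2⟩ := h.prefixSum (k := m) (by omega)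
    have z1 := ht (m - 2) (by omega) (by omega)
    have z2 := ht (m - 1) (by omega) (by omega)
    have y1 := (h.2 (m - 2) (by omega)).1
    have y2 := (h.2 (m - 1) (by omega)).1
    have l0 := hL m (by omega) (by omega)
    have l1 := hL (m + 1) (by omega) (by omega)
    have w1 := prefixSum_step x (show m - 1 = m - 2 + 1 by omega)
    have w2 := prefixSum_step x (show m = m - 1 + 1 by omega)
    have d1 := prefixSum_step x (show p + (m - 1) = p + (m - 2) + 1 by omega)
    have d2 := prefixSum_step x (show p + m = p + (m - 1) + 1 by omega)
    have d3 := prefixSum_step x (show p + (m + 1) = p + m + 1 by omega)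
    have d4 := prefixSum_step x (show p + (m + 2) = p + (m + 1) + 1 by omega)
    have u0 := prefixSum_succ x (q + m)
    have u1 := prefixSum_succ x (q + m + 1)
    have u2 := prefixSum_bounds hx (i := q + m + 1 + 1) (j := q + m + 3) (by omega)
    have u3 := prefixSum_bounds hx (i := q + m + 1 + 1) (j := q + m + 4) (by omega)
    have u4 := prefixSum_bounds hx (i := q + m + 1 + 1) (j := q + m + 5) (by omega)
    obtain ⟨ℓ', c', hret⟩ := exists_returnAt hr (n := q - p + 3)
      (v := prefixSum x q - prefixSum x p + 1) (i := p + (m - 2)) (by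
        rw [show p + (m - 2) + (q - p + 3) = q + m + 1 by omega]; linarith)
    have := hM m p q (by omega) h _ _ _ hret
    obtain ⟨a1, -, a3, a4, -⟩ := hret
    have hℓ : 5 ≤ ℓ' := by
      by_contra hlt
      rcases (show ℓ' = 1 ∨ ℓ' = 2 ∨ ℓ' = 3 ∨ ℓ' = 4 by omega) with rfl | rfl | rfl | rfl
      · rw [show p + (m - 2) + 1 + (q - p + 3) = q + m + 1 + 1 by omega,
          show p + (m - 2) + 1 = p + (m - 1) by omega] at a3
        linarith
      · rw [show p + (m - 2) + 2 + (q - p + 3) = q + m + 3 by omega,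
          show p + (m - 2) + 2 = p + m by omega] at a3
        linarith
      · rw [show p + (m - 2) + 3 + (q - p + 3) = q + m + 4 by omega,
          show p + (m - 2) + 3 = p + (m + 1) by omega] at a3
        linarith
      · rw [show p + (m - 2) + 4 + (q - p + 3) = q + m + 5 by omega,
          show p + (m - 2) + 4 = p + (m + 2) by omega] at a3
        linarith
    have b := prefixSum_bounds hx (i := p + (m + 2)) (j := p + (m - 2) + ℓ') (by omega)
    push_cast [Nat.cast_sub (show 2 ≤ m by omega)] at b
    omega
  · obtain rfl : r₁ = 1 := by omega
    subst hr2
    have tri : ∃ (f s : ℕ), s ≠ 2 ∧ RunAt x 1 f s := by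
      rcases two.2 with h | h
      · exact ⟨f₂, s₂, by omega, F₂⟩
      · exact ⟨f₁, s₁, by omega, F₁⟩
    obtain ⟨f, s, hs, F⟩ := tri
    have sp := F.pos
    obtain ⟨M, hM⟩ := h3.restrict G₁ G₂ F.returnAt_pair_one (by omega) (by omega) (by omega)
    obtain ⟨m, p, q, hm, h, ht, hL, hU0, hU1⟩ := rows M
    have hpq := h.1
    obtain ⟨S1, -⟩ := h.prefixSum (k := m - 1) (by omega)
    obtain ⟨-, S2⟩ := h.prefixSum (k := m) (by omega)
    have z2 := ht (m - 1) (by omega) (by omega)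
    have y2 := (h.2 (m - 1) (by omega)).1
    have l0 := hL m (by omega) (by omega)
    have w2 := prefixSum_step x (show m = m - 1 + 1 by omega)
    have d2 := prefixSum_step x (show p + m = p + (m - 1) + 1 by omega)
    have d3 := prefixSum_step x (show p + (m + 1) = p + m + 1 by omega)
    have u0 := prefixSum_succ x (q + m)
    have u1 := prefixSum_succ x (q + m + 1)
    have u2 := prefixSum_bounds hx (i := q + m + 1 + 1) (j := q + m + 3) (by omega)
    obtain ⟨ℓ', c', hret⟩ := exists_returnAt hr (n := q - p + 2)
      (v := prefixSum x q - prefixSum x p + 1) (i := p + (m - 1)) (by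
        rw [show p + (m - 1) + (q - p + 2) = q + m + 1 by omega]; linarith)
    have := hM m p q (by omega) h _ _ _ hret
    obtain ⟨a1, -, a3, a4, -⟩ := hret
    have hℓ : 3 ≤ ℓ' := by
      by_contra hlt
      rcases (show ℓ' = 1 ∨ ℓ' = 2 by omega) with rfl | rfl
      · rw [show p + (m - 1) + 1 + (q - p + 2) = q + m + 1 + 1 by omega,
          show p + (m - 1) + 1 = p + m by omega] at a3
        linarith
      · rw [show p + (m - 1) + 2 + (q - p + 2) = q + m + 3 by omega,
          show p + (m - 1) + 2 = p + (m + 1) by omega] at a3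
        linarith
    have b := prefixSum_bounds hx (i := p + (m + 1)) (j := p + (m - 1) + ℓ') (by omega)
    push_cast [Nat.cast_sub (show 1 ≤ m by omega)] at b
    omega

end TwoTwo

section DoubleLetters

variable {x : ℕ → ℤ}

lemma exists_runAt_ge (hx : IsBinary x) (hr : FactorsRecur x) (hp : NotEventuallyPeriodic x)
    {y : ℤ} (hy : y = 0 ∨ y = 1) {i L : ℕ} (hL : 1 ≤ L) (h : ∀ k < L, x (i + k) = y) :
    ∃ e t, RunAt x y e t ∧ L ≤ t := by
  obtain ⟨z, hz, -⟩ := exists_next_letter hx hp 0 (a := 1 - y) (by omega)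
  rw [zero_add] at hz
  obtain ⟨j, hj, hj'⟩ := hr i L (z + 1)
  have hj1 : ∀ k < L, x (j + k) = y := fun k hk => by rw [hj' k hk, h k hk]
  have hlast := hj1 (L - 1) (by omega)
  obtain ⟨g, g1, g2, g3, g4⟩ := exists_trailing_block (x := x) (i := z) (m := j + L) (by omega)
    (by rw [show j + L - 1 = j + (L - 1) by omega]; omega)
  rw [show j + L - 1 = j + (L - 1) by omega, hlast] at g3 g4
  obtain ⟨t, ht⟩ := exists_runAt hx hp (e := g) hy (by have := hx g; omega) (g4 _ (by omega) (by omega))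
  have hgj : g < j := by
    by_contra hge
    have := hj1 (g - j) (by omega)
    rw [show j + (g - j) = g by omega] at this
    omega
  refine ⟨g, t, ht, ?_⟩
  by_contra hlt
  have p := ht.pos
  have := ht.right
  rw [g4 _ (by omega) (by omega)] at this
  omega

lemma exists_two_runs (hx : IsBinary x) (hr : FactorsRecur x) (hp : NotEventuallyPeriodic x) :
    ∃ y e t e' t', (y = 0 ∨ y = 1) ∧ RunAt x y e t ∧ RunAt x y e' t' ∧ t < t' := by
  obtain ⟨i, hi, -⟩ := exists_next_letter hx hp 0 (a := 0) (Or.inl rfl)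
  obtain ⟨j, hj, -⟩ := exists_next_letter hx hp 0 (a := 1) (Or.inr rfl)
  rw [zero_add] at hi hj
  obtain ⟨m, p, q, hm, h, h0, h1⟩ := exists_rightSpecial_prefix hx hr hp (i + j + 2)
  obtain ⟨y, hy⟩ : ∃ y, y = x (m - 1) := ⟨_, rfl⟩
  have hy' : y = 0 ∨ y = 1 := hy ▸ hx (m - 1)
  obtain ⟨z, hz, hzm⟩ : ∃ z, x z ≠ y ∧ z + 2 ≤ m := by
    rcases hy' with rfl | rfl
    · exact ⟨j, by omega, by omega⟩
    · exact ⟨i, by omega, by omega⟩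
  obtain ⟨g, g1, g2, g3, g4⟩ := exists_trailing_block (x := x) (i := z) (m := m) (by omega) (by omega)
  rw [← hy] at g3 g4
  have key : ∃ p q, (∀ k < m, x (p + k) = x k ∧ x (q + k) = x k) ∧ x (p + m) = y ∧
      x (q + m) = 1 - y := by
    rcases hy' with rfl | rfl
    · exact ⟨p, q, h, h0, by omega⟩
    · exact ⟨q, p, fun k hk => (h k hk).symm, h1, by omega⟩
  obtain ⟨p, q, h, h0, h1⟩ := key
  have hg : x g = 1 - y := by have := hx g; omega
  obtain ⟨t, Rp⟩ := exists_runAt hx hp (e := p + g) hy' (by rw [(h g (by omega)).1, hg])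
    (by rw [add_assoc, (h _ (by omega)).1]; exact g4 _ (by omega) (by omega))
  refine ⟨y, q + g, m - 1 - g, p + g, t, hy', ⟨by omega, by rw [(h g (by omega)).2, hg],
    fun k k1 k2 => ?_, by rw [show q + g + (m - 1 - g) + 1 = q + m by omega, h1]⟩, Rp, ?_⟩
  · rw [show k = q + (k - q) by omega, (h _ (by omega)).2]
    exact g4 _ (by omega) (by omega)
  · by_contra hle
    have e2 := Rp.right
    rcases Nat.lt_or_ge (g + t + 1) m with h' | h'
    · rw [show p + g + t + 1 = p + (g + t + 1) by omega, (h _ h').1, g4 _ (by omega) h'] at e2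
      omega
    · rw [show p + g + t + 1 = p + m by omega, h0] at e2
      omega

lemma blocks_of_runs (hx : IsBinary x) (hp : NotEventuallyPeriodic x)
    {r s s' : ℕ} (hr : 1 ≤ r) (hs : 1 ≤ s) (hss : s < s') (hR : ∀ e t, RunAt x 0 e t → t = r)
    (hS : ∀ e t, RunAt x 1 e t → t = s ∨ t = s') : Blocks x r s s' := by
  refine ⟨hr, hs, hss, fun e h1 h0 => ?_, fun e h0 h1 => ?_⟩
  · obtain ⟨t, ht⟩ := exists_runAt hx hp (Or.inl rfl) (by rw [h1]; rfl) h0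
    obtain rfl := hR _ _ ht
    exact ⟨ht.mid, ht.right⟩
  · obtain ⟨t, ht⟩ := exists_runAt hx hp (Or.inr rfl) (by rw [h0]; rfl) h1
    rcases hS _ _ ht with rfl | rfl
    · exact ⟨ht.mid, Or.inl ht.right⟩
    · exact ⟨fun k k1 k2 => ht.mid k k1 (by omega), Or.inr ⟨ht.mid, ht.right⟩⟩

lemma false_of_double_letters_of_unique (hx : IsBinary x) (hr : FactorsRecur x)
    (hp : NotEventuallyPeriodic x) (h3 : AtMostThreeReturns x) {i : ℕ} (h0 : x i = 0)
    (h1 : x (i + 1) = 0) (hU : ∀ e t e' t', RunAt x 0 e t → RunAt x 0 e' t' → t = t') : False := by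
  obtain ⟨e, r, hE, h2⟩ := exists_runAt_ge hx hr hp (L := 2) (i := i) (Or.inl rfl) (by omega)
    (fun k hk => by interval_cases k; exacts [h0, h1])
  obtain ⟨y, e₁, s, e₂, s', hy, F₁, F₂, hlt⟩ := exists_two_runs hx hr hp
  rcases hy with rfl | rfl
  · have := hU _ _ _ _ F₁ F₂; omega
  · refine (blocks_of_runs hx hp (r := r) (s := s) (s' := s') (by omega) F₁.pos hlt
      (fun e' t ht => hU _ _ _ _ ht hE) (fun e' t ht => ?_)).false_of_two_le hx hr hp h3 h2
    have := h3.runs h0 h1 F₁ F₂ ht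
    omega

/-- A word in which no class has four returns cannot contain both `00` and `11`. -/
lemma false_of_double_letters (hx : IsBinary x) (hr : FactorsRecur x) (hp : NotEventuallyPeriodic x)
    (h3 : AtMostThreeReturns x) {i j : ℕ} (h0 : x i = 0) (h0' : x (i + 1) = 0) (h1 : x j = 1)
    (h1' : x (j + 1) = 1) : False := by
  by_cases hU : ∀ e t e' t', RunAt x 0 e t → RunAt x 0 e' t' → t = t'
  · exact false_of_double_letters_of_unique hx hr hp h3 h0 h0' hU
  by_cases hV : ∀ e t e' t', RunAt x 1 e t → RunAt x 1 e' t' → t = t'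
  · refine false_of_double_letters_of_unique hx.compl hr.compl hp.compl h3.compl (i := j)
      (by omega) (by omega) fun e t e' t' h h' => hV e t e' t' ?_ ?_
    · simpa using h.of_compl
    · simpa using h'.of_compl
  push Not at hU hV
  obtain ⟨e₁, r₁, e₂, r₂, E₁, E₂, hne⟩ := hU
  obtain ⟨f₁, s₁, f₂, s₂, F₁, F₂, hne'⟩ := hV
  wlog hlt : r₁ < r₂ generalizing e₁ r₁ e₂ r₂
  · exact this e₂ r₂ e₁ r₁ E₂ E₁ hne.symm (by omega)
  wlog hlt' : s₁ < s₂ generalizing f₁ s₁ f₂ s₂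
  · exact this f₂ s₂ f₁ s₁ F₂ F₁ hne'.symm (by omega)
  have hS : ∀ e t, RunAt x 1 e t → t = s₁ ∨ t = s₂ := fun e t ht => by
    have := h3.runs h0 h0' F₁ F₂ ht; omega
  have hR : ∀ e t, RunAt x 0 e t → t = r₁ ∨ t = r₂ := fun e t ht => by
    have := h3.compl.runs (i := j) (by omega) (by omega) E₁.compl E₂.compl ht.compl; omega
  by_cases hrows : ∀ M, ∃ m p q, M ≤ m ∧ (∀ k < m, x (p + k) = x k ∧ x (q + k) = x k) ∧
      x (p + m) = 0 ∧ x (q + m) = 1 ∧ x (m - 1) = 0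
  · exact false_of_two_two hx hr hp h3 h1 h1' hR hlt hS hlt' E₁ E₂ F₁ F₂ hrows
  · push Not at hrows
    obtain ⟨M₀, hM₀⟩ := hrows
    refine false_of_two_two hx.compl hr.compl hp.compl h3.compl (i := i) (by omega) (by omega)
      (r₁ := s₁) (r₂ := s₂) (s₁ := r₁) (s₂ := r₂)
      (fun e t h => hS e t (by simpa using h.of_compl)) hlt'
      (fun e t h => hR e t (by simpa using h.of_compl)) hlt
      (by simpa using F₁.compl) (by simpa using F₂.compl) (by simpa using E₁.compl)
      (by simpa using E₂.compl) fun M => ?_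
    obtain ⟨m, p, q, hm, h, e0, e1⟩ := exists_rightSpecial_prefix hx hr hp (M + M₀)
    refine ⟨m, q, p, by omega, fun k hk => ?_, by omega, by omega, ?_⟩
    · have := h k hk; omega
    · have := hM₀ m p q (by omega) h e0 e1
      have := hx (m - 1)
      omega

end DoubleLetters

section IsolatedZeros

variable {x : ℕ → ℤ}

lemma eq_one_of_isolated_zeros (hno : ∀ i, x i = 0 → x (i + 1) = 1) {e t : ℕ}
    (h : RunAt x 0 e t) : t = 1 := by
  have p := h.pos
  by_contra hne
  have h1 := h.mid (e + 1) (by omega) (by omega)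
  have h2 := h.mid (e + 1 + 1) (by omega) (by omega)
  have := hno _ h1
  omega

/-- If zeros are isolated, the lengths of two blocks of ones differ by at most one. -/
lemma runs_le_succ (hx : IsBinary x) (hr : FactorsRecur x) (hp : NotEventuallyPeriodic x)
    (h3 : AtMostThreeReturns x) (hno : ∀ i, x i = 0 → x (i + 1) = 1) {s f e t : ℕ}
    (hmin : ∀ e t, RunAt x 1 e t → s ≤ t) (F : RunAt x 1 f s) (E : RunAt x 1 e t) : t ≤ s + 1 := by
  by_contra hlt
  have s1 := F.pos
  have Ra : ReturnAt x (s + 1) s f 1 0 := by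
    have a1 := F.sum le_rfl
    have a2 := F.sum_right
    refine ⟨one_pos, ?_, ?_, ?_, fun k _ _ => by omega⟩
    · rw [show f + (s + 1) = f + 1 + s by omega, a1]; ring
    · rw [show f + 1 + (s + 1) = f + s + 2 by omega, a2, prefixSum_succ, F.left]; ring
    · rw [prefixSum_succ, F.left]; ring
  have Rb : ReturnAt x (s + 1) s (e + t + 1 - s) 1 1 := by
    have a1 := E.sum_right
    have a2 := E.sum (k := t - s) (by omega)
    have a3 := E.mid (e + 1 + (t - s)) (by omega) (by omega)
    have a4 := prefixSum_succ x (e + t + 2)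
    have a5 := E.right
    rw [sub_self] at a5
    have a6 := hno _ a5
    rw [a6] at a4
    have a7 := prefixSum_succ x (e + 1 + (t - s))
    rw [a3] at a7
    push_cast [Nat.cast_sub (show s ≤ t by omega)] at a2
    rw [show e + t + 1 - s = e + 1 + (t - s) by omega]
    refine ⟨one_pos, ?_, ?_, ?_, fun k _ _ => by omega⟩
    · rw [show e + 1 + (t - s) + (s + 1) = e + t + 2 by omega]; linarith
    · rw [show e + 1 + (t - s) + 1 + (s + 1) = e + t + 2 + 1 by omega]; linarith
    · linarith
  have Rt : ∀ e t, RunAt x 1 e t → s < t → ReturnAt x (s + 1) s e (t - s + 1) (t - s) := by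
    intro e t E hst
    refine ⟨by omega, ?_, ?_, ?_, fun k k1 k2 => ?_⟩
    · rw [show e + (s + 1) = e + 1 + s by omega, E.sum (by omega)]; ring
    · rw [show e + (t - s + 1) + (s + 1) = e + t + 2 by omega, E.sum_right,
        show e + (t - s + 1) = e + 1 + (t - s) by omega, E.sum (by omega)]
      push_cast [Nat.cast_sub hst.le]; ring
    · rw [show e + (t - s + 1) = e + 1 + (t - s) by omega, E.sum (by omega)]
      push_cast [Nat.cast_sub hst.le]; ring
    · rw [show e + k + (s + 1) = e + 1 + (k + s) by omega, E.sum (by omega),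
        show e + k = e + 1 + (k - 1) by omega, E.sum (by omega)]
      push_cast [Nat.cast_sub k1]; omega
  have hS : ∀ e' t', RunAt x 1 e' t' → t' = s ∨ t' = t := by
    intro e' t' E'
    have := hmin _ _ E'
    by_contra hne
    exact h3.four Ra Rb (Rt _ _ E (by omega)) (Rt _ _ E' (by omega)) (by omega) (by omega) (by omega)
      (by omega) (by omega) (by omega)
  exact (blocks_of_runs hx hp le_rfl s1 (by omega) (fun _ _ h => eq_one_of_isolated_zeros hno h)
    hS).false_of_one hx hr hp h3 (by omega)

/-- The smallest failure of balance: there are words `0 p 0` and `1 p 1`, of sums `v` and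
`v + 2`, which are the only factors of the length `n` with their respective sums, all other
factors of length `n` having sum `v + 1`. -/
lemma exists_minimal_unbalanced (hx : IsBinary x) (hb : ¬ IsBalanced x) :
    ∃ (n : ℕ) (v : ℤ) (i j : ℕ), 2 ≤ n ∧
      prefixSum x (i + n) - prefixSum x i = v ∧ prefixSum x (j + n) - prefixSum x j = v + 2 ∧
      (∀ i, v ≤ prefixSum x (i + n) - prefixSum x i ∧ prefixSum x (i + n) - prefixSum x i ≤ v + 2) ∧
      (∀ i, prefixSum x (i + n) - prefixSum x i = v → x i = 0 ∧ x (i + (n - 1)) = 0) ∧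
      (∀ i, prefixSum x (i + n) - prefixSum x i = v + 2 → x i = 1 ∧ x (i + (n - 1)) = 1) ∧
      (∀ i j, prefixSum x (i + n) - prefixSum x i = v → prefixSum x (j + n) - prefixSum x j = v + 2 →
        ∀ k, 1 ≤ k → k < n - 1 → x (i + k) = x (j + k)) ∧
      ∀ m < n, ∀ i j, prefixSum x (i + m) - prefixSum x i ≤ prefixSum x (j + m) - prefixSum x j + 1 := by
  have hex : ∃ n i j, prefixSum x (j + n) - prefixSum x j + 1 < prefixSum x (i + n) - prefixSum x i := by
    unfold IsBalanced at hb
    push Not at hb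
    exact hb
  classical
  obtain ⟨n, hn⟩ : ∃ n, n = Nat.find hex := ⟨_, rfl⟩
  have hmin : ∀ m < n, ∀ i j,
      prefixSum x (i + m) - prefixSum x i ≤ prefixSum x (j + m) - prefixSum x j + 1 := by
    intro m hm i j
    have := Nat.find_min hex (hn ▸ hm)
    push Not at this
    exact this i j
  obtain ⟨j, i, hij⟩ : ∃ i j, prefixSum x (j + n) - prefixSum x j + 1 < prefixSum x (i + n) - prefixSum x i :=
    hn ▸ Nat.find_spec hex
  have hn2 : 2 ≤ n := by
    by_contra hlt
    rcases (show n = 0 ∨ n = 1 by omega) with h | h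
    · rw [h] at hij
      simp only [add_zero] at hij
      omega
    · rw [h, prefixSum_succ, prefixSum_succ] at hij
      have := hx i
      have := hx j
      omega
  have key : ∀ i j, prefixSum x (i + n) - prefixSum x i + 1 < prefixSum x (j + n) - prefixSum x j →
      ∀ k, 1 ≤ k → k < n →
        prefixSum x (j + k) - prefixSum x j = prefixSum x (i + k) - prefixSum x i + 1 ∧
        prefixSum x (j + n) - prefixSum x j = prefixSum x (i + n) - prefixSum x i + 2 := by
    intro i j h k k1 k2
    have h1 := hmin k k2 j i
    have h2 := hmin (n - k) (by omega) (j + k) (i + k)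
    rw [show j + k + (n - k) = j + n by omega, show i + k + (n - k) = i + n by omega] at h2
    constructor <;> linarith
  have hlet : ∀ i j, prefixSum x (i + n) - prefixSum x i + 1 < prefixSum x (j + n) - prefixSum x j →
      x i = 0 ∧ x (i + (n - 1)) = 0 ∧ x j = 1 ∧ x (j + (n - 1)) = 1 ∧
        ∀ k, 1 ≤ k → k < n - 1 → x (i + k) = x (j + k) := by
    intro i j h
    have h1 := (key i j h 1 le_rfl (by omega)).1
    have h2 := (key i j h (n - 1) (by omega) (by omega))
    rw [prefixSum_succ, prefixSum_succ] at h1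
    rw [prefixSum_step x (show i + n = i + (n - 1) + 1 by omega),
      prefixSum_step x (show j + n = j + (n - 1) + 1 by omega)] at h2
    have a1 := hx i
    have a2 := hx j
    have a3 := hx (i + (n - 1))
    have a4 := hx (j + (n - 1))
    refine ⟨by omega, by omega, by omega, by omega, fun k k1 k2 => ?_⟩
    have h3 := (key i j h k k1 (by omega)).1
    have h4 := (key i j h (k + 1) (by omega) (by omega)).1
    rw [← add_assoc, ← add_assoc, prefixSum_succ, prefixSum_succ] at h4
    linarith
  obtain ⟨v, hv⟩ : ∃ v, v = prefixSum x (i + n) - prefixSum x i := ⟨_, rfl⟩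
  have hv2 : prefixSum x (j + n) - prefixSum x j = v + 2 := by
    have := (key i j hij 1 le_rfl (by omega)).2
    rw [this, hv]
  have hbd : ∀ a, v ≤ prefixSum x (a + n) - prefixSum x a ∧ prefixSum x (a + n) - prefixSum x a ≤ v + 2 := by
    intro a
    constructor
    · by_contra hlt
      have := (key a j (by omega) 1 le_rfl (by omega)).2
      omega
    · by_contra hlt
      have := (key i a (by omega) 1 le_rfl (by omega)).2
      omega
  refine ⟨n, v, i, j, hn2, hv.symm, hv2, hbd, fun a ha => ?_, fun a ha => ?_, fun a b ha hb => ?_, hmin⟩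
  · have := hlet a j (by omega)
    exact ⟨this.1, this.2.1⟩
  · have := hlet i a (by omega)
    exact ⟨this.2.2.1, this.2.2.2.1⟩
  · exact (hlet a b (by omega)).2.2.2.2

lemma isBalanced_of_isolated_zeros (hx : IsBinary x) (hr : FactorsRecur x)
    (hp : NotEventuallyPeriodic x) (h3 : AtMostThreeReturns x) (hno : ∀ i, x i = 0 → x (i + 1) = 1) :
    IsBalanced x := by
  by_contra hb
  obtain ⟨n, v, iA, iB, hn2, hA, hB, hbd, LA, LB, LAB, -⟩ := exists_minimal_unbalanced hx hb
  obtain ⟨z₀, hz₀, -⟩ := exists_next_letter hx hp 1 (a := 0) (Or.inl rfl)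
  obtain ⟨t₀, R₀⟩ := exists_runAt hx hp (e := 1 + z₀) (Or.inr rfl) (by rw [hz₀]; rfl) (hno _ hz₀)
  have hex : ∃ s f, RunAt x 1 f s := ⟨t₀, _, R₀⟩
  classical
  obtain ⟨s, hs⟩ : ∃ s, s = Nat.find hex := ⟨_, rfl⟩
  obtain ⟨f, F⟩ : ∃ f, RunAt x 1 f s := hs ▸ Nat.find_spec hex
  have hmin : ∀ e t, RunAt x 1 e t → s ≤ t := fun e t h => hs ▸ Nat.find_min' hex ⟨e, h⟩
  have hmax : ∀ e t, RunAt x 1 e t → t ≤ s + 1 := fun e t h => runs_le_succ hx hr hp h3 hno hmin F h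
  have s1 := F.pos
  have long : ∀ i, ¬ ∀ k < s + 2, x (i + k) = 1 := fun i h => by
    obtain ⟨e, t, h1, h2⟩ := exists_runAt_ge hx hr hp (Or.inr rfl) (by omega) h
    have := hmax _ _ h1
    omega
  have after : ∀ e, x e = 0 → ∃ t, RunAt x 1 e t := fun e he =>
    exists_runAt hx hp (Or.inr rfl) (by rw [he]; rfl) (hno _ he)
  obtain ⟨jA, hjA, hjA'⟩ := hr iA n 2
  obtain ⟨jB, hjB, hjB'⟩ := hr iB n 2
  have A : prefixSum x (jA + n) - prefixSum x jA = v := by rw [prefixSum_shift hjA' le_rfl, hA]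
  have B : prefixSum x (jB + n) - prefixSum x jB = v + 2 := by rw [prefixSum_shift hjB' le_rfl, hB]
  have shape : 2 * s + 3 ≤ n ∧ (∀ k, 1 ≤ k → k ≤ s → x (jA + k) = 1) ∧ x (jA + (s + 1)) = 0 := by
    obtain ⟨a0, a1⟩ := LA _ A
    obtain ⟨b0, b1⟩ := LB _ B
    obtain ⟨t, T⟩ := after _ a0
    have t1 := hmin _ _ T
    have t2 : t + 1 < n - 1 := by
      by_contra hle
      have hnt : n - 1 = t + 1 := by
        by_contra hne
        have := T.mid (jA + (n - 1)) (by omega) (by omega)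
        omega
      apply long jB
      intro k hk
      rcases Nat.eq_zero_or_pos k with rfl | hk0
      · exact b0
      rcases Nat.lt_or_ge k (n - 1) with h | h
      · rw [← LAB _ _ A B k hk0 h]; exact T.mid _ (by omega) (by omega)
      · rw [show k = n - 1 by omega]; exact b1
    have t3 : t = s := by
      by_contra hne
      apply long jB
      intro k hk
      rcases Nat.eq_zero_or_pos k with rfl | hk0
      · exact b0
      · rw [← LAB _ _ A B k hk0 (by omega)]; exact T.mid _ (by omega) (by omega)
    subst t3
    have r0 := T.right
    rw [sub_self] at r0
    obtain ⟨t', T'⟩ := after _ r0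
    have t1' := hmin _ _ T'
    refine ⟨?_, fun k k1 k2 => T.mid _ (by omega) (by omega), r0⟩
    by_contra hlt
    have := T'.mid (jA + (n - 1)) (by omega) (by omega)
    omega
  obtain ⟨hn, sh1, sh0⟩ := shape
  have SA : ∀ i, prefixSum x (i + n) - prefixSum x i = v → ∀ k < n, x (i + k) = x (jA + k) := by
    intro i hi k hk
    rcases Nat.eq_zero_or_pos k with rfl | hk0
    · rw [add_zero, add_zero, (LA _ hi).1, (LA _ A).1]
    rcases Nat.lt_or_ge k (n - 1) with h | h
    · rw [LAB _ _ hi B k hk0 h, LAB _ _ A B k hk0 h]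
    · rw [show k = n - 1 by omega, (LA _ hi).2, (LA _ A).2]
  have SB : ∀ i, prefixSum x (i + n) - prefixSum x i = v + 2 →
      x i = 1 ∧ ∀ k, 1 ≤ k → k < n - 1 → x (i + k) = x (jA + k) := fun i hi =>
    ⟨(LB _ hi).1, fun k k1 k2 => (LAB _ _ A hi k k1 k2).symm⟩
  have occ : ∀ e, prefixSum x (e + 1 + (n - 1)) - prefixSum x (e + 1) =
      prefixSum x (e + n) - prefixSum x e - x e := fun e => by
    rw [show e + 1 + (n - 1) = e + n by omega, prefixSum_succ]; ring
  have step : ∀ e, prefixSum x (e + 1 + n) - prefixSum x (e + 1) =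
      prefixSum x (e + n) - prefixSum x e - x e + x (e + n) := fun e => by
    rw [show e + 1 + n = e + n + 1 by omega, prefixSum_succ, prefixSum_succ]; ring
  have prev : ∀ e, x (e + 1) = 0 → x e = 1 := fun e he => by
    rcases hx e with h | h
    · have := hno e h; omega
    · exact h
  have noB : ∀ e, x (e + 1) = 0 → prefixSum x (e + n) - prefixSum x e ≠ v + 2 := fun e he hB' => by
    have := (SB _ hB').2 1 le_rfl (by omega)
    rw [sh1 1 le_rfl (by omega)] at this
    omega
  have Ra : ReturnAt x (n - 1) v jA 1 0 := by
    obtain ⟨e, rfl⟩ : ∃ e, jA = e + 1 := ⟨jA - 1, by omega⟩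
    have a0 := (LA _ A).1
    refine ⟨one_pos, ?_, ?_, by rw [prefixSum_succ, a0]; ring, fun k _ _ => by omega⟩
    · have h1 := noB e a0
      have h2 := step e
      have h3 := hx (e + n)
      have h4 := prev e a0
      have h5 := hbd e
      have h6 := LA e
      rw [occ]; omega
    · rw [occ]; omega
  have Rb : ReturnAt x (n - 1) v (jA + 1) 1 1 := by
    have a0 := (LA _ A).1
    have a1 := sh1 1 le_rfl (by omega)
    refine ⟨one_pos, ?_, ?_, by rw [prefixSum_succ, a1]; ring, fun k _ _ => by omega⟩
    · rw [occ]; omega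
    · have h2 := step jA
      have h3 := hx (jA + n)
      have h5 := LA (jA + 1)
      have h6 := hbd (jA + 1)
      rw [occ]; omega
  have Rabb : ReturnAt x (n - 1) v (jB - 1) 3 2 := by
    obtain ⟨e, rfl⟩ : ∃ e, jB = e + 2 := ⟨jB - 2, by omega⟩
    obtain ⟨b0, b1⟩ := SB _ B
    have ones : ∀ k < s + 1, x (e + 2 + k) = 1 := fun k hk => by
      rcases Nat.eq_zero_or_pos k with rfl | hk0
      · exact b0
      · rw [b1 k hk0 (by omega)]; exact sh1 k hk0 (by omega)
    have z : x (e + 1) = 0 := by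
      by_contra hne
      refine long (e + 1) fun k hk => ?_
      rcases Nat.eq_zero_or_pos k with rfl | hk0
      · have := hx (e + 1); rw [add_zero]; omega
      · have := ones (k - 1) (by omega)
        rwa [show e + 2 + (k - 1) = e + 1 + k by omega] at this
    have y := prev _ z
    have o1 := ones 1 (by omega)
    have s0 := step e
    have s1' : prefixSum x (e + 2 + n) - prefixSum x (e + 2) =
        prefixSum x (e + 1 + n) - prefixSum x (e + 1) - x (e + 1) + x (e + 1 + n) := step (e + 1)
    have s2 := step (e + 2)
    have x1 := hx (e + n)
    have x2 := hx (e + 1 + n)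
    have x3 := hx (e + 2 + n)
    have q1 := hbd e
    have q2 := LA e
    rw [show e + 2 - 1 = e + 1 by omega]
    refine ⟨by omega, ?_, ?_, ?_, fun k k1 k2 => ?_⟩
    · have := noB e z
      rw [occ]; omega
    · have : prefixSum x (e + 3 + n) - prefixSum x (e + 3) ≠ v + 2 := fun h => by
        obtain ⟨c0, c1⟩ := SB _ h
        refine long (e + 2) fun k hk => ?_
        rcases Nat.lt_or_ge k (s + 1) with h' | h'
        · exact ones k h'
        · rw [show e + 2 + k = e + 3 + s by omega, c1 s s1 (by omega)]
          exact sh1 s s1 le_rfl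
      have q3 := hbd (e + 3)
      have q4 := LA (e + 3)
      have q5 : x (e + 3) = 1 := o1
      rw [show e + 1 + 3 + (n - 1) = e + 3 + 1 + (n - 1) by omega,
        show e + 1 + 3 = e + 3 + 1 by omega, occ]
      omega
    · rw [show e + 1 + 3 = e + 2 + 1 + 1 by omega, prefixSum_succ, prefixSum_succ,
        show e + 2 = e + 1 + 1 by omega, prefixSum_succ, z, show e + 1 + 1 = e + 2 by omega, b0, o1]
      ring
    · rcases (show k = 1 ∨ k = 2 by omega) with rfl | rfl
      · rw [occ]; omega
      · rw [show e + 1 + 2 = e + 2 + 1 by omega, occ]; omega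
  have ordinary : ∃ z, 1 ≤ z ∧ x z = 0 ∧ prefixSum x (z + n) - prefixSum x z ≠ v ∧
      prefixSum x (z + 1 + n) - prefixSum x (z + 1) ≠ v + 2 := by
    by_contra hne
    push Not at hne
    obtain ⟨m, p, q, hm, h, h0, h1⟩ := exists_rightSpecial_prefix hx hr hp (z₀ + 4 + (s + 2))
    have m1 : x (m - 1) = 1 := by
      have := hno (p + (m - 1))
      rw [(h _ (by omega)).1, show p + (m - 1) + 1 = p + m by omega] at this
      have := hx (m - 1)
      omega
    obtain ⟨g, g1, g2, g3, g4⟩ := exists_trailing_block (x := x) (i := 1 + z₀) (m := m) (by omega)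
      (by omega)
    rw [m1] at g3 g4
    have hg : x g = 0 := by have := hx g; omega
    have gp := (h g (by omega)).1
    have gq := (h g (by omega)).2
    rw [hg] at gp gq
    have hgs : m = g + s + 1 := by
      have Rp : RunAt x 1 (p + g) (m - 1 - g) := ⟨by omega, by rw [gp]; rfl, fun k k1 k2 => by
        rw [show k = p + (k - p) by omega, (h _ (by omega)).1]
        exact g4 _ (by omega) (by omega),
        by rw [show p + g + (m - 1 - g) + 1 = p + m by omega, h0]; rfl⟩
      obtain ⟨t, T⟩ := after _ gq
      have ht : m - 1 - g < t := by
        by_contra hle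
        have e2 := T.right
        rw [sub_self] at e2
        rcases Nat.lt_or_ge (g + t + 1) m with h' | h'
        · rw [show q + g + t + 1 = q + (g + t + 1) by omega, (h _ h').2, g4 _ (by omega) h'] at e2
          omega
        · rw [show q + g + t + 1 = q + m by omega, h1] at e2
          omega
      have := hmin _ _ Rp
      have := hmax _ _ T
      omega
    have hg1 : x (g - 1) = 1 := prev _ (by rw [show g - 1 + 1 = g by omega]; exact hg)
    obtain ⟨z, z1, z2, z3, z4⟩ := exists_trailing_block (x := x) (i := 1 + z₀) (m := g) (by omega)
      (by omega)
    rw [hg1] at z3 z4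
    have hz : x z = 0 := by have := hx z; omega
    have zp := (h z (by omega)).1
    have zq := (h z (by omega)).2
    rw [hz] at zp zq
    have kinds : ∀ a, (∀ k < m, x (a + k) = x k) →
        (prefixSum x (a + z + n) - prefixSum x (a + z) = v ∧ g = z + s + 1) ∨
        (prefixSum x (a + z + 1 + n) - prefixSum x (a + z + 1) = v + 2 ∧ g = z + s + 2) := by
      intro a ha
      have zero_at : ∀ k, z < k → k < m → x (a + k) = 0 → k = g := fun k k1 k2 hk => by
        rw [ha k k2] at hk
        by_contra hne
        rcases Nat.lt_or_gt_of_ne hne with h' | h'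
        · have := z4 k k1 h'; omega
        · have := g4 k h' k2; omega
      by_cases hA' : prefixSum x (a + z + n) - prefixSum x (a + z) = v
      · refine Or.inl ⟨hA', ?_⟩
        have := SA _ hA' (s + 1) (by omega)
        rw [sh0] at this
        rw [← zero_at (z + (s + 1)) (by omega) (by omega) (by rw [← add_assoc]; exact this)]
        omega
      · have hB' := hne (a + z) (by omega) (by rw [ha _ (by omega), hz]) hA'
        refine Or.inr ⟨hB', ?_⟩
        have := (SB _ hB').2 (s + 1) (by omega) (by omega)
        rw [sh0, show a + z + 1 + (s + 1) = a + (z + s + 2) by omega] at this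
        by_cases hm' : z + s + 2 < m
        · exact (zero_at _ (by omega) hm' this).symm
        · omega
    rcases kinds p (fun k hk => (h k hk).1) with ⟨k1, k2⟩ | ⟨k1, k2⟩ <;>
      rcases kinds q (fun k hk => (h k hk).2) with ⟨k3, k4⟩ | ⟨k3, k4⟩
    · have e1 := SA _ k1 (2 * s + 2) (by omega)
      have e2 := SA _ k3 (2 * s + 2) (by omega)
      rw [show p + z + (2 * s + 2) = p + m by omega] at e1
      rw [show q + z + (2 * s + 2) = q + m by omega] at e2
      omega
    · omega
    · omega
    · rcases Nat.lt_or_ge (2 * s + 2) (n - 1) with hlt | hge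
      · have e1 := (SB _ k1).2 (2 * s + 2) (by omega) hlt
        have e2 := (SB _ k3).2 (2 * s + 2) (by omega) hlt
        rw [show p + z + 1 + (2 * s + 2) = p + m by omega] at e1
        rw [show q + z + 1 + (2 * s + 2) = q + m by omega] at e2
        omega
      · have e1 := (LB _ k1).2
        rw [show p + z + 1 + (n - 1) = p + m by omega] at e1
        omega
  obtain ⟨z, z1, z0, zA, zB⟩ := ordinary
  have Rab : ReturnAt x (n - 1) v z 2 1 := by
    obtain ⟨e, rfl⟩ : ∃ e, z = e + 1 := ⟨z - 1, by omega⟩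
    have y := prev _ z0
    have o1 := hno _ z0
    have s0 := step e
    have x1 := hx (e + n)
    have q1 := hbd e
    have q2 := hbd (e + 1)
    have q3 := hbd (e + 1 + 1)
    have q4 := LA e
    have q5 := LA (e + 1 + 1)
    have q6 := noB e z0
    have q7 := LB (e + 1)
    refine ⟨by omega, ?_, ?_, ?_, fun k k1 k2 => ?_⟩
    · rw [occ]; omega
    · have s1' := step (e + 1)
      rw [show e + 1 + 2 = e + 1 + 1 + 1 by omega, occ (e + 1 + 1)]; omega
    · rw [show e + 1 + 2 = e + 1 + 1 + 1 by omega, prefixSum_succ, prefixSum_succ, z0, o1]; ring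
    · rw [show k = 1 by omega, occ]; omega
  exact h3.four Ra Rb Rabb Rab (by omega) (by omega) (by omega) (by omega) (by omega) (by omega)

/-- If no abelian class has four returns, then the word is balanced. -/
theorem AtMostThreeReturns.isBalanced (hx : IsBinary x) (hr : FactorsRecur x)
    (hp : NotEventuallyPeriodic x) (h3 : AtMostThreeReturns x) : IsBalanced x := by
  by_cases h0 : ∀ i, x i = 0 → x (i + 1) = 1
  · exact isBalanced_of_isolated_zeros hx hr hp h3 h0
  by_cases h1 : ∀ i, x i = 1 → x (i + 1) = 0
  · exact (isBalanced_of_isolated_zeros hx.compl hr.compl hp.compl h3.compl fun i hi => by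
      have := h1 i (by omega); omega).of_compl
  push Not at h0 h1
  obtain ⟨i, hi, hi'⟩ := h0
  obtain ⟨j, hj, hj'⟩ := h1
  have := hx (i + 1)
  have := hx (j + 1)
  exact (false_of_double_letters hx hr hp h3 hi (by omega) hj (by omega)).elim

end IsolatedZeros

section Factors

variable {β : Type*} (w : ℕ → β)

@[simp] lemma length_factorAt (i n : ℕ) : (factorAt w i n).length = n := by simp [factorAt]

lemma factorAt_eq_iff {i j n : ℕ} :
    factorAt w i n = factorAt w j n ↔ ∀ k < n, w (i + k) = w (j + k) := by
  simp [factorAt, List.map_inj_left]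

lemma factorAt_succ (i n : ℕ) : factorAt w i (n + 1) = factorAt w i n ++ [w (i + n)] := by
  simp [factorAt, List.range_succ]

lemma setOf_isFactor (n : ℕ) :
    {u : List β | u.length = n ∧ IsFactor w u} = Set.range fun i => factorAt w i n := by
  ext u
  constructor
  · rintro ⟨rfl, i, hi⟩
    exact ⟨i, hi⟩
  · rintro ⟨i, rfl⟩
    exact ⟨length_factorAt w i n, i, by rw [length_factorAt]⟩

end Factors

section Complexity

variable {x : ℕ → ℤ}

lemma finite_range_factorAt (hx : IsBinary x) (n : ℕ) :
    (Set.range fun i => factorAt x i n).Finite := by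
  induction n with
  | zero => exact (Set.finite_singleton []).subset (by rintro _ ⟨i, rfl⟩; simp [factorAt])
  | succ n ih =>
    refine (ih.image2 (fun u a => u ++ [a]) (Set.toFinite {(0 : ℤ), 1})).subset ?_
    rintro _ ⟨i, rfl⟩
    exact ⟨_, ⟨i, rfl⟩, x (i + n), hx _, (factorAt_succ x i n).symm⟩

/-- The factors of length `n` which can be followed by both letters. -/
def specialFactors (x : ℕ → ℤ) (n : ℕ) : Set (List ℤ) :=
  {u | ∃ i j, factorAt x i n = u ∧ factorAt x j n = u ∧ x (i + n) = 0 ∧ x (j + n) = 1}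

lemma ncard_range_factorAt_succ (hx : IsBinary x) (n : ℕ) :
    (Set.range fun i => factorAt x i (n + 1)).ncard =
      (Set.range fun i => factorAt x i n).ncard + (specialFactors x n).ncard := by
  have fin := finite_range_factorAt hx n
  let E : ℤ → Set (List ℤ) := fun a => {u | ∃ i, factorAt x i n = u ∧ x (i + n) = a}
  have hE : ∀ a, E a ⊆ Set.range fun i => factorAt x i n := by
    rintro a u ⟨i, hi, -⟩
    exact ⟨i, hi⟩
  have fE := fun a => fin.subset (hE a)
  have inj : ∀ a : ℤ, Function.Injective fun u : List ℤ => u ++ [a] := fun a u v h => by simpa using h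
  have h1 : (Set.range fun i => factorAt x i (n + 1)) =
      (fun u => u ++ [0]) '' E 0 ∪ (fun u => u ++ [1]) '' E 1 := by
    ext u
    constructor
    · rintro ⟨i, rfl⟩
      rcases hx (i + n) with h | h
      · exact Or.inl ⟨_, ⟨i, rfl, h⟩, by simp [factorAt_succ, h]⟩
      · exact Or.inr ⟨_, ⟨i, rfl, h⟩, by simp [factorAt_succ, h]⟩
    · rintro (⟨_, ⟨i, rfl, h⟩, rfl⟩ | ⟨_, ⟨i, rfl, h⟩, rfl⟩) <;>
        exact ⟨i, by simp [factorAt_succ, h]⟩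
  have h2 : Disjoint ((fun u => u ++ [0]) '' E 0) ((fun u => u ++ [(1 : ℤ)]) '' E 1) := by
    rw [Set.disjoint_left]
    rintro _ ⟨u, -, rfl⟩ ⟨v, -, h⟩
    simp at h
  have h3 : (Set.range fun i => factorAt x i n) = E 0 ∪ E 1 := by
    refine Set.Subset.antisymm ?_ (Set.union_subset (hE 0) (hE 1))
    rintro _ ⟨i, rfl⟩
    rcases hx (i + n) with h | h
    · exact Or.inl ⟨i, rfl, h⟩
    · exact Or.inr ⟨i, rfl, h⟩
  have h4 : specialFactors x n = E 0 ∩ E 1 := by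
    ext u
    constructor
    · rintro ⟨i, j, h1, h2, h3, h4⟩
      exact ⟨⟨i, h1, h3⟩, j, h2, h4⟩
    · rintro ⟨⟨i, h1, h3⟩, j, h2, h4⟩
      exact ⟨i, j, h1, h2, h3, h4⟩
  rw [h1, Set.ncard_union_eq h2 ((fE 0).image _) ((fE 1).image _),
    Set.ncard_image_of_injective _ (inj 0), Set.ncard_image_of_injective _ (inj 1), h3, h4,
    Set.ncard_union_add_ncard_inter _ _ (fE 0) (fE 1)]

lemma IsBalanced.ncard_specialFactors (hb : IsBalanced x) (hx : IsBinary x) (hr : FactorsRecur x)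
    (hp : NotEventuallyPeriodic x) (n : ℕ) : (specialFactors x n).ncard = 1 := by
  obtain ⟨m, p, q, hm, h, h0, h1⟩ := exists_rightSpecial_prefix hx hr hp n
  have mem : factorAt x (p + (m - n)) n ∈ specialFactors x n := by
    refine ⟨p + (m - n), q + (m - n), rfl, (factorAt_eq_iff x).2 fun k hk => ?_, ?_, ?_⟩
    · rw [add_assoc, add_assoc, (h _ (by omega)).1, (h _ (by omega)).2]
    · rw [show p + (m - n) + n = p + m by omega, h0]
    · rw [show q + (m - n) + n = q + m by omega, h1]
  have aux : ∀ i j k, k < n → x (i + k) = 1 → x (j + k) = 0 → x (i + n) = 1 → x (j + n) = 0 →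
      ¬ ∀ l, k < l → l < n → x (i + l) = x (j + l) := by
    intro i j k hk i0 j0 i1 j1 heq
    have h1 := prefixSum_shift (x := x) (i := j + (k + 1)) (j := i + (k + 1)) (m := n - k - 1)
      (fun l hl => by
        rw [add_assoc i, add_assoc j]; exact heq (k + 1 + l) (by omega) (by omega)) le_rfl
    rw [show i + (k + 1) + (n - k - 1) = i + n by omega,
      show j + (k + 1) + (n - k - 1) = j + n by omega, ← add_assoc, ← add_assoc, prefixSum_succ,
      prefixSum_succ] at h1
    have h2 := hb (n - k + 1) (i + k) (j + k)
    rw [show i + k + (n - k + 1) = i + n + 1 by omega,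
      show j + k + (n - k + 1) = j + n + 1 by omega, prefixSum_succ, prefixSum_succ] at h2
    linarith
  rw [Set.ncard_eq_one]
  refine ⟨_, Set.eq_singleton_iff_unique_mem.2 ⟨mem, ?_⟩⟩
  suffices ∀ u ∈ specialFactors x n, ∀ v ∈ specialFactors x n, u = v from
    fun u hu => this u hu _ mem
  rintro _ ⟨i, j, rfl, hij, i0, j1⟩ _ ⟨i', j', rfl, hij', i0', j1'⟩
  rw [factorAt_eq_iff] at hij hij' ⊢
  suffices ∀ d ≤ n, ∀ l, n - d ≤ l → l < n → x (i + l) = x (i' + l) from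
    fun k hk => this n le_rfl k (by omega) hk
  intro d
  induction d with
  | zero => intro _ l h1 h2; omega
  | succ d ih =>
    intro hd l h1 h2
    rcases Nat.lt_or_ge l (n - d) with hl | hl
    · have eqs := ih (by omega)
      rcases hx (i + l) with e | e <;> rcases hx (i' + l) with e' | e'
      · rw [e, e']
      · refine (aux j' i l h2 (by rw [hij' l h2, e']) e j1' i0 fun k k1 k2 => ?_).elim
        rw [hij' k k2, eqs k (by omega) k2]
      · refine (aux j i' l h2 (by rw [hij l h2, e]) e' j1 i0' fun k k1 k2 => ?_).elim
        rw [hij k k2, eqs k (by omega) k2]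
      · rw [e, e']
    · exact ih (by omega) l hl h2

lemma ncard_range_factorAt_zero : (Set.range fun i => factorAt x i 0).ncard = 1 := by
  simp [factorAt, Set.range_const]

theorem IsBalanced.ncard_range_factorAt (hb : IsBalanced x) (hx : IsBinary x) (hr : FactorsRecur x)
    (hp : NotEventuallyPeriodic x) (n : ℕ) : (Set.range fun i => factorAt x i n).ncard = n + 1 := by
  induction n with
  | zero => exact ncard_range_factorAt_zero
  | succ n ih => rw [ncard_range_factorAt_succ hx, ih, hb.ncard_specialFactors hx hr hp]

/-- If the only word of length `n - 1` which can be followed by both letters is a proper prefix of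
the lighter word of a minimal unbalanced pair, then reading on from the heavier word leads to a
cycle. -/
lemma false_of_special_eq (hp : NotEventuallyPeriodic x) {n i j : ℕ} (hn : 2 ≤ n)
    (i0 : x i = 0) (j1 : x j = 1) (hW : prefixSum x (j + n) - prefixSum x j =
      prefixSum x (i + n) - prefixSum x i + 2)
    (heq : ∀ k, 1 ≤ k → k < n - 1 → x (i + k) = x (j + k))
    (hmin : ∀ m < n, ∀ i j,
      prefixSum x (i + m) - prefixSum x i ≤ prefixSum x (j + m) - prefixSum x j + 1)
    (hs : ∀ a b, (∀ k < n - 1, x (a + k) = x (b + k)) → x (a + (n - 1)) ≠ x (b + (n - 1)) →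
      ∀ k < n - 1, x (a + k) = x (i + k))
    (hc : ∀ j, (∀ e < n, ¬ ∀ k < n - 1, x (j + e + k) = x (i + k)) →
      ∃ e e', e < e' ∧ e' < n ∧ ∀ k < n - 1, x (j + e + k) = x (j + e' + k)) : False := by
  have pre : ∀ k, 1 ≤ k → k ≤ n - 1 →
      prefixSum x (j + k) - prefixSum x j = prefixSum x (i + k) - prefixSum x i + 1 := by
    intro k h1 h2
    have := prefixSum_shift (x := x) (i := i + 1) (j := j + 1) (m := n - 2) (fun l hl => by
      rw [add_assoc, add_assoc]; exact (heq _ (by omega) (by omega)).symm) (k := k - 1) (by omega)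
    rw [show i + 1 + (k - 1) = i + k by omega, show j + 1 + (k - 1) = j + k by omega,
      prefixSum_succ, prefixSum_succ] at this
    linarith
  have avoid : ∀ e < n, ¬ ∀ k < n - 1, x (j + e + k) = x (i + k) := by
    intro e he h
    rcases Nat.eq_zero_or_pos e with rfl | e1
    · have := h 0 (by omega)
      simp only [add_zero] at this
      omega
    have h1 := prefixSum_shift (x := x) h (k := n - e) (by omega)
    have h2 := pre (n - e) (by omega) (by omega)
    have h3 := pre e e1 (by omega)
    have h4 := hmin (n - e) (by omega) j (i + e)
    rw [show j + e + (n - e) = j + n by omega] at h1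
    rw [show i + e + (n - e) = i + n by omega] at h4
    linarith
  obtain ⟨e, e', h1, h2, h3⟩ := hc j avoid
  have key : ∀ t, (∀ k < n - 1, x (j + e + t + k) = x (j + e' + t + k)) ∧
      ¬ ∀ k < n - 1, x (j + e + t + k) = x (i + k) := by
    intro t
    induction t using Nat.strong_induction_on with
    | _ t ih =>
      constructor
      · rcases t with _ | t
        · exact h3
        obtain ⟨p1, p2⟩ := ih t (by omega)
        intro k hk
        rcases Nat.lt_or_ge (k + 1) (n - 1) with hk' | hk'
        · have := p1 (k + 1) hk'
          rwa [show j + e + t + (k + 1) = j + e + (t + 1) + k by omega,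
            show j + e' + t + (k + 1) = j + e' + (t + 1) + k by omega] at this
        · by_contra hne
          refine p2 (hs _ _ p1 ?_)
          rwa [show j + e + t + (n - 1) = j + e + (t + 1) + k by omega,
            show j + e' + t + (n - 1) = j + e' + (t + 1) + k by omega]
      · intro h
        rcases Nat.lt_or_ge (e + t) n with ht | ht
        · exact avoid _ ht (by simpa only [add_assoc] using h)
        · obtain ⟨p1, p2⟩ := ih (t - (e' - e)) (by omega)
          apply p2
          intro k hk
          rw [p1 k hk, ← h k hk, show j + e' + (t - (e' - e)) = j + e + t by omega]
  obtain ⟨m, m1, m2⟩ := hp (j + e) (e' - e) (by omega)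
  have := (key (m - (j + e))).1 0 (by omega)
  rw [show j + e + (m - (j + e)) + 0 = m by omega,
    show j + e' + (m - (j + e)) + 0 = m + (e' - e) by omega] at this
  exact m2 this.symm

theorem isBalanced_of_ncard_range_factorAt (hx : IsBinary x) (hp : NotEventuallyPeriodic x)
    (hc : ∀ n, (Set.range fun i => factorAt x i n).ncard = n + 1) : IsBalanced x := by
  by_contra hb
  obtain ⟨n, v, i, j, hn, hi, hj, -, LA, LB, LAB, hmin⟩ := exists_minimal_unbalanced hx hb
  have sp : ∀ m a b a' b', (∀ k < m, x (a + k) = x (b + k)) → x (a + m) ≠ x (b + m) →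
      (∀ k < m, x (a' + k) = x (b' + k)) → x (a' + m) ≠ x (b' + m) →
      ∀ k < m, x (a + k) = x (a' + k) := by
    intro m a b a' b' h1 h2 h3 h4
    have card : (specialFactors x m).ncard = 1 := by
      have := ncard_range_factorAt_succ hx m
      rw [hc, hc] at this
      omega
    obtain ⟨u, hu⟩ := Set.ncard_eq_one.1 card
    have mem : ∀ a b, (∀ k < m, x (a + k) = x (b + k)) → x (a + m) ≠ x (b + m) →
        factorAt x a m = u := by
      intro a b h1 h2
      rw [← Set.mem_singleton_iff, ← hu]
      have h3 := (factorAt_eq_iff x).2 h1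
      rcases hx (a + m) with h | h <;> rcases hx (b + m) with h' | h'
      · omega
      · exact ⟨a, b, rfl, h3.symm, h, h'⟩
      · exact ⟨b, a, h3.symm, rfl, h', h⟩
      · omega
    exact (factorAt_eq_iff x).1 ((mem a b h1 h2).trans (mem a' b' h3 h4).symm)
  have pig : ∀ i j, (∀ e < n, ¬ ∀ k < n - 1, x (j + e + k) = x (i + k)) →
      ∃ e e', e < e' ∧ e' < n ∧ ∀ k < n - 1, x (j + e + k) = x (j + e' + k) := by
    intro i j h
    have fin := finite_range_factorAt hx (n - 1)
    have card : ((Set.range fun i => factorAt x i (n - 1)) \ {factorAt x i (n - 1)}).ncard < 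
        (Set.Iio n).ncard := by
      have h1 := Set.ncard_sdiff_singleton_add_one (Set.mem_range_self (f := fun i => factorAt x i (n - 1)) i) fin
      rw [hc] at h1
      have h2 : (Set.Iio n).ncard = n := by
        rw [← Finset.coe_Iio, Set.ncard_coe_finset, Nat.card_Iio]
      omega
    obtain ⟨e, he, e', he', hne, heq⟩ := Set.exists_ne_map_eq_of_ncard_lt_of_maps_to card
      (f := fun e => factorAt x (j + e) (n - 1)) (fun e he => ⟨⟨_, rfl⟩, fun h' =>
        h e he ((factorAt_eq_iff x).1 h')⟩) (fin.subset Set.sdiff_subset)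
    have heq' := (factorAt_eq_iff x).1 heq
    rcases Nat.lt_or_gt_of_ne hne with h | h
    · exact ⟨e, e', h, he', heq'⟩
    · exact ⟨e', e, h, he, fun k hk => (heq' k hk).symm⟩
  obtain ⟨i0, i1⟩ := LA _ hi
  obtain ⟨j0, j1⟩ := LB _ hj
  have mid := LAB _ _ hi hj
  have suf : ∀ a b, (∀ k < n - 1, x (a + k) = x (b + k)) → x (a + (n - 1)) ≠ x (b + (n - 1)) →
      ∀ k, 1 ≤ k → k < n - 1 → x (a + k) = x (i + k) := by
    intro a b h1 h2 k k1 k2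
    have := sp (n - 2) (a + 1) (b + 1) (i + 1) (j + 1) (fun l hl => by
        rw [add_assoc, add_assoc]; exact h1 _ (by omega))
      (by rwa [show a + 1 + (n - 2) = a + (n - 1) by omega, show b + 1 + (n - 2) = b + (n - 1) by omega])
      (fun l hl => by rw [add_assoc, add_assoc]; exact mid _ (by omega) (by omega))
      (by rw [show i + 1 + (n - 2) = i + (n - 1) by omega, show j + 1 + (n - 2) = j + (n - 1) by omega,
        i1, j1]; omega) (k - 1) (by omega)
    rwa [show a + 1 + (k - 1) = a + k by omega, show i + 1 + (k - 1) = i + k by omega] at this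
  by_cases H : ∃ a b, (∀ k < n - 1, x (a + k) = x (b + k)) ∧ x (a + (n - 1)) ≠ x (b + (n - 1)) ∧
      x a = 1
  · obtain ⟨a, b, h1, h2, h3⟩ := H
    have hs : ∀ a' b', (∀ k < n - 1, x (a' + k) = x (b' + k)) → x (a' + (n - 1)) ≠ x (b' + (n - 1)) →
        ∀ k < n - 1, x (a' + k) = x (j + k) := by
      intro a' b' h1' h2' k hk
      rw [sp _ _ _ _ _ h1' h2' h1 h2 k hk]
      rcases Nat.eq_zero_or_pos k with rfl | hk0
      · rw [add_zero, add_zero, h3, j0]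
      · rw [suf a b h1 h2 k hk0 hk, mid k hk0 hk]
    refine false_of_special_eq (x := fun k => 1 - x k) hp.compl hn (i := j) (j := i) (by omega)
      (by omega) ?_ (fun k k1 k2 => by rw [mid k k1 k2]) ?_ (fun a b h1 h2 k hk => ?_) (fun i h => ?_)
    · simp only [prefixSum_compl]
      push_cast
      linarith
    · intro m hm a b
      have := hmin m hm b a
      simp only [prefixSum_compl]
      push_cast
      linarith
    · have := hs a b (fun k hk => by have := h1 k hk; omega) (by omega) k hk
      omega
    · obtain ⟨e, e', h1, h2, h3⟩ := pig j i fun e he h' => h e he fun k hk => by rw [h' k hk]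
      exact ⟨e, e', h1, h2, fun k hk => by rw [h3 k hk]⟩
  · refine false_of_special_eq hp hn i0 j0 (by omega) mid hmin (fun a b h1 h2 k hk => ?_) (pig i)
    rcases Nat.eq_zero_or_pos k with rfl | hk0
    · have := hx a
      rw [add_zero, add_zero, i0]
      by_contra hne
      exact H ⟨a, b, h1, h2, by omega⟩
    · exact suf a b h1 h2 k hk0 hk

end Complexity

section Slope

variable {x : ℕ → ℤ}

/-- The sums of the windows of length `n` differ from `n * a` by less than one, and `a` is
irrational. -/
def HasSlope (x : ℕ → ℤ) (a : ℝ) : Prop :=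
  (∀ i n : ℕ, |((prefixSum x (i + n) - prefixSum x i : ℤ) : ℝ) - n * a| < 1) ∧
    ∀ n : ℕ, 0 < n → ∀ k : ℤ, (n : ℝ) * a ≠ k

lemma IsBalanced.compl (h : IsBalanced x) : IsBalanced fun k => 1 - x k :=
  IsBalanced.of_compl (by simpa using h)

lemma IsBalanced.mul_bounds (hb : IsBalanced x) (n i t : ℕ) :
    t * (prefixSum x (i + n) - prefixSum x i - 1) ≤ prefixSum x (t * n) ∧
      prefixSum x (t * n) ≤ t * (prefixSum x (i + n) - prefixSum x i + 1) := by
  induction t with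
  | zero => simp [prefixSum]
  | succ t ih =>
    have h1 := hb n i (t * n)
    have h2 := hb n (t * n) i
    rw [show (t + 1) * n = t * n + n by ring]
    push_cast
    constructor <;> linarith [ih.1, ih.2]

/-- If all windows of length `n` of a balanced word have sum at least `k`, and `n` divides the
slope `k / n`, then all of them have sum `k`. -/
lemma FactorsRecur.window_eq (hr : FactorsRecur x) {n : ℕ} (hn : 0 < n) {k : ℤ}
    (hk : ∀ i, k ≤ prefixSum x (i + n) - prefixSum x i)
    (hs : ∀ i t : ℕ, prefixSum x (i + t * n) - prefixSum x i ≤ t * k + 1) (i : ℕ) :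
    prefixSum x (i + n) - prefixSum x i = k := by
  by_contra hne
  let E : Set ℕ := {j | k + 1 ≤ prefixSum x (j + n) - prefixSum x j}
  have inf : E.Infinite := Set.infinite_of_forall_exists_gt fun N => by
    obtain ⟨j, hj, hj'⟩ := hr i n (N + 1)
    refine ⟨j, ?_, hj⟩
    have := hk i
    have h2 := prefixSum_shift hj' le_rfl
    change k + 1 ≤ _
    omega
  obtain ⟨a, ha, b, hb, hab, hmod⟩ := inf.exists_ne_map_eq_of_mapsTo (f := fun j => j % n)
    (t := Set.Iio n) (fun j _ => Nat.mod_lt _ hn) (Set.finite_Iio n)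
  have aux : ∀ a ∈ E, ∀ b ∈ E, a < b → a % n = b % n → False := by
    intro a ha b hb hab hmod
    obtain ⟨t, ht⟩ := (Nat.modEq_iff_dvd' hab.le).1 hmod
    have low : ∀ s : ℕ, 1 ≤ s → s * k + 1 ≤ prefixSum x (a + s * n) - prefixSum x a := by
      intro s hs
      induction s, hs using Nat.le_induction with
      | base =>
        have : k + 1 ≤ _ := ha
        simpa using this
      | succ s _ ih =>
        have := hk (a + s * n)
        rw [show a + (s + 1) * n = a + s * n + n by ring]
        push_cast
        linarith
    have ht1 : 1 ≤ t := by
      rcases Nat.eq_zero_or_pos t with rfl | h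
      · omega
      · exact h
    have h1 := low t ht1
    have hb' : b = a + t * n := by rw [mul_comm t n]; omega
    have h2 := hs a (t + 1)
    have h3 : k + 1 ≤ _ := hb
    rw [show a + (t + 1) * n = b + n by rw [hb']; ring] at h2
    rw [← hb'] at h1
    push_cast at h2
    linarith
  rcases Nat.lt_or_gt_of_ne hab with h | h
  · exact aux a ha b hb h hmod
  · exact aux b hb a ha h hmod.symm

lemma NotEventuallyPeriodic.exists_window_ne (hp : NotEventuallyPeriodic x) {n : ℕ} (hn : 0 < n)
    (k : ℤ) : ∃ i, prefixSum x (i + n) - prefixSum x i ≠ k := by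
  by_contra! h
  obtain ⟨i, -, hi⟩ := hp 0 n hn
  apply hi
  have h1 := h i
  have h2 := h (i + 1)
  rw [show i + 1 + n = i + n + 1 by omega, prefixSum_succ, prefixSum_succ] at h2
  linarith

theorem IsBalanced.exists_hasSlope (hb : IsBalanced x) (hr : FactorsRecur x)
    (hp : NotEventuallyPeriodic x) : ∃ a, HasSlope x a := by
  let W : ℕ → ℕ → ℤ := fun n i => prefixSum x (i + n) - prefixSum x i
  have cmp : ∀ n m i j : ℕ, 0 < n → 0 < m → ((W n i : ℝ) - 1) / n ≤ ((W m j : ℝ) + 1) / m := by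
    intro n m i j hn hm
    have h1 := (hb.mul_bounds n i m).1
    have h2 := (hb.mul_bounds m j n).2
    rw [mul_comm n m] at h2
    have h3 : (m : ℤ) * (W n i - 1) ≤ n * (W m j + 1) := h1.trans h2
    rw [div_le_div_iff₀ (by exact_mod_cast hn) (by exact_mod_cast hm)]
    have h4 : ((m * (W n i - 1) : ℤ) : ℝ) ≤ ((n * (W m j + 1) : ℤ) : ℝ) := by exact_mod_cast h3
    push_cast at h4
    linarith
  let S : Set ℝ := {r | ∃ n i : ℕ, 0 < n ∧ r = ((W n i : ℝ) - 1) / n}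
  have ne : S.Nonempty := ⟨_, 1, 0, one_pos, rfl⟩
  have bdd : BddAbove S := ⟨((W 1 0 : ℝ) + 1) / (1 : ℕ), by
    rintro _ ⟨n, i, hn, rfl⟩
    exact cmp n 1 i 0 hn one_pos⟩
  obtain ⟨a, ha⟩ : ∃ a, a = sSup S := ⟨_, rfl⟩
  have weak : ∀ i n : ℕ, (W n i : ℝ) - 1 ≤ n * a ∧ n * a ≤ (W n i : ℝ) + 1 := by
    intro i n
    rcases Nat.eq_zero_or_pos n with rfl | hn
    · simp [W]
    have hn' : (0 : ℝ) < n := by exact_mod_cast hn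
    constructor
    · have : ((W n i : ℝ) - 1) / n ≤ a := ha ▸ le_csSup bdd ⟨n, i, hn, rfl⟩
      rwa [div_le_iff₀ hn', mul_comm] at this
    · have : a ≤ ((W n i : ℝ) + 1) / n := ha ▸ csSup_le ne (by
        rintro _ ⟨m, j, hm, rfl⟩
        exact cmp m n j i hm hn)
      rwa [le_div_iff₀ hn', mul_comm] at this
  have irr : ∀ n : ℕ, 0 < n → ∀ k : ℤ, (n : ℝ) * a ≠ k := by
    intro n hn k hk
    have bd : ∀ i t : ℕ, prefixSum x (i + t * n) - prefixSum x i ≤ t * k + 1 ∧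
        t * k ≤ prefixSum x (i + t * n) - prefixSum x i + 1 := by
      intro i t
      obtain ⟨h1, h2⟩ := weak i (t * n)
      push_cast at h1 h2
      rw [mul_assoc, hk] at h1 h2
      have h3 : ((prefixSum x (i + t * n) - prefixSum x i : ℤ) : ℝ) - 1 ≤ ((t * k : ℤ) : ℝ) := by
        push_cast; exact_mod_cast h1
      have h4 : ((t * k : ℤ) : ℝ) ≤ ((prefixSum x (i + t * n) - prefixSum x i + 1 : ℤ) : ℝ) := by
        exact_mod_cast h2
      have h5 : prefixSum x (i + t * n) - prefixSum x i - 1 ≤ t * k := by exact_mod_cast h3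
      have h6 : t * k ≤ prefixSum x (i + t * n) - prefixSum x i + 1 := by exact_mod_cast h4
      exact ⟨by linarith, h6⟩
    obtain ⟨e, he⟩ := hp.exists_window_ne hn k
    rcases lt_or_gt_of_ne he with h | h
    · have := FactorsRecur.window_eq (k := n - k) hr.compl hn (fun i => by
        have := hb n i e
        simp only [prefixSum_compl]
        push_cast
        linarith) (fun i t => by
          have := (bd i t).2
          simp only [prefixSum_compl]
          push_cast
          linarith) e
      simp only [prefixSum_compl] at this
      push_cast at this
      exact he (by linarith)
    · exact he (FactorsRecur.window_eq hr hn (fun i => by have := hb n e i; linarith)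
        (fun i t => (bd i t).1) e)
  refine ⟨a, fun i n => ?_, irr⟩
  rcases Nat.eq_zero_or_pos n with rfl | hn
  · simp
  obtain ⟨h1, h2⟩ := weak i n
  have h3 := irr n hn (W n i - 1)
  have h4 := irr n hn (W n i + 1)
  push_cast at h3 h4
  have h1' := lt_of_le_of_ne h1 h3.symm
  have h2' := lt_of_le_of_ne h2 h4
  change |(W n i : ℝ) - n * a| < 1
  rw [abs_lt]
  constructor <;> linarith

lemma HasSlope.compl {a : ℝ} (h : HasSlope x a) : HasSlope (fun k => 1 - x k) (1 - a) := by
  refine ⟨fun i n => ?_, fun n hn k hk => ?_⟩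
  · have := h.1 i n
    rw [abs_lt] at this ⊢
    simp only [prefixSum_compl]
    push_cast at this ⊢
    constructor <;> linarith [this.1, this.2]
  · exact h.2 n hn (n - k) (by push_cast; linarith)

/-- In a word of irrational slope every class of windows has at least two returns. -/
lemma HasSlope.exists_two_returns {a : ℝ} (h : HasSlope x a) (hr : FactorsRecur x) {n : ℕ} {v : ℤ}
    {i : ℕ} (hi : prefixSum x (i + n) - prefixSum x i = v) :
    ∃ i j ℓ ℓ' c c', ReturnAt x n v i ℓ c ∧ ReturnAt x n v j ℓ' c' ∧ ¬ (ℓ = ℓ' ∧ c = c') := by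
  by_contra! H
  obtain ⟨ℓ, c, hR⟩ := exists_returnAt hr hi
  have ev : ∀ t : ℕ, prefixSum x (i + t * ℓ + n) - prefixSum x (i + t * ℓ) = v ∧
      prefixSum x (i + t * ℓ) - prefixSum x i = t * c := by
    intro t
    induction t with
    | zero => simpa using hi
    | succ t ih =>
      obtain ⟨ℓ', c', hR'⟩ := exists_returnAt hr ih.1
      obtain ⟨rfl, rfl⟩ := H _ _ _ _ _ _ hR hR'
      obtain ⟨-, -, h2, h3, -⟩ := hR'
      rw [show i + (t + 1) * ℓ = i + t * ℓ + ℓ by ring]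
      refine ⟨h2, ?_⟩
      push_cast
      linarith [ih.2]
  apply h.2 ℓ hR.1 c
  have bd : ∀ t : ℕ, |(t : ℝ) * (c - ℓ * a)| < 1 := by
    intro t
    have := h.1 i (t * ℓ)
    rw [(ev t).2] at this
    push_cast at this
    rwa [mul_sub, ← mul_assoc]
  by_contra hne
  have pos : 0 < |(c : ℝ) - ℓ * a| := abs_pos.2 fun h' => hne (by linarith)
  obtain ⟨t, ht⟩ := exists_nat_gt (1 / |(c : ℝ) - ℓ * a|)
  rw [div_lt_iff₀ pos] at ht
  have := bd t
  rw [abs_mul, Nat.abs_cast] at this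
  linarith

end Slope

section ThreeReturns

/-- The three gap theorem for a word of slope `a`, in terms of its prefix sums `A i`, where `φ t` is
the integer part of `t * a`: the windows of length `n` and minimal sum `v` have at most three
returns. -/
lemma return_mem_of_slope {A φ : ℕ → ℝ} {a v : ℝ} {n : ℕ}
    (hG : ∀ i j : ℕ, A i - i * a < A j - j * a + 1)
    (hφ : ∀ t : ℕ, φ t ≤ t * a ∧ t * a < φ t + 1)
    (hA : ∀ i t, A (i + t) = A i + φ t ∨ A (i + t) = A i + φ t + 1)
    (hn : φ n = v) :
    ∃ p q : ℕ, ∀ i t, 0 < t → A (i + n) = A i + v → A (i + t + n) = A (i + t) + v →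
      (∀ k, 0 < k → k < t → A (i + k + n) ≠ A (i + k) + v) →
      (t = p ∧ A (i + t) = A i + φ p + 1) ∨ (t = q ∧ A (i + t) = A i + φ q) ∨
        (t = p + q ∧ A (i + t) = A i + φ p + φ q + 1) := by
  let Pos : Set ℕ := {t | 0 < t ∧ φ t + n * a < v + t * a}
  let Neg : Set ℕ := {t | 0 < t ∧ t * a + n * a < φ t + v + 1}
  refine ⟨sInf Pos, sInf Neg, fun i t ht hi hit hfirst => ?_⟩
  have hn' := hφ n
  have fin : Pos.Nonempty → Neg.Nonempty → sInf Pos + sInf Neg ≤ t →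
      t = sInf Pos + sInf Neg ∧ A (i + t) = A i + φ (sInf Pos) + φ (sInf Neg) + 1 := by
    intro hP hN hle
    obtain ⟨p0, pP⟩ := Nat.sInf_mem hP
    obtain ⟨q0, qN⟩ := Nat.sInf_mem hN
    generalize sInf Pos = p at *
    generalize sInf Neg = q at *
    have P1 := hφ p
    have Q1 := hφ q
    have ap : A (i + p) = A i + φ p := by
      refine (hA i p).resolve_right fun h => ?_
      have h1 := (hA (i + p) n).resolve_left (by rw [hn]; exact hfirst p p0 (by omega))
      have h2 := hG (i + p + n) (i + n)
      push_cast at h2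
      linarith
    have apq : A (i + (p + q)) = A i + φ p + φ q + 1 := by
      have e1 := hA (i + p) q
      have e2 := hA (i + q) p
      rw [add_assoc] at e1
      rw [add_assoc, add_comm q p] at e2
      rcases e1 with e1 | e1
      · rcases hA i q with h | h
        · have h1 := (hA (i + q) n).resolve_left (by rw [hn]; exact hfirst q q0 (by omega))
          have h2 := hG (i + q + n) (i + (p + q))
          push_cast at h2
          linarith
        · rcases e2 with e2 | e2 <;> linarith
      · linarith
    have occ : A (i + (p + q) + n) = A (i + (p + q)) + v := by
      rcases hA (i + (p + q)) n with h | h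
      · linarith
      · have h2 := hG (i + (p + q) + n) (i + p)
        push_cast at h2
        linarith
    have : t = p + q := by
      by_contra hne
      exact hfirst (p + q) (by omega) (by omega) occ
    exact ⟨this, by rw [this, apq]⟩
  have T := hφ t
  rcases hA i t with h | h
  · have tN : t ∈ Neg := by
      refine ⟨ht, ?_⟩
      have h1 := hG i (i + t + n)
      push_cast at h1
      linarith
    have hq := Nat.sInf_le tN
    rcases Nat.eq_or_lt_of_le hq with hq | hq
    · exact Or.inr (Or.inl ⟨hq.symm, by rw [h, hq]⟩)
    obtain ⟨q0, qN⟩ := Nat.sInf_mem ⟨t, tN⟩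
    have key : t - sInf Neg ∈ Pos := by
      generalize sInf Neg = q at *
      refine ⟨by omega, ?_⟩
      have S := hφ (t - q)
      have Q := hφ q
      have e := hA (i + q) (t - q)
      rw [show i + q + (t - q) = i + t by omega] at e
      push_cast [Nat.cast_sub hq.le] at S ⊢
      rcases hA i q with h' | h'
      · have h1 := (hA (i + q) n).resolve_left (by rw [hn]; exact hfirst q q0 hq)
        have h2 := hG (i + q + n) (i + t + n)
        push_cast at h2
        rcases e with e | e <;> linarith
      · have h2 := hG (i + q) (i + t)
        push_cast at h2
        rcases e with e | e <;> linarith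
    have hp := Nat.sInf_le key
    exact Or.inr (Or.inr (fin ⟨_, key⟩ ⟨_, tN⟩ (by omega)))
  · have tP : t ∈ Pos := by
      refine ⟨ht, ?_⟩
      have h1 := hG (i + t) (i + n)
      push_cast at h1
      linarith
    have hp := Nat.sInf_le tP
    rcases Nat.eq_or_lt_of_le hp with hp | hp
    · exact Or.inl ⟨hp.symm, by rw [h, hp]⟩
    obtain ⟨p0, pP⟩ := Nat.sInf_mem ⟨t, tP⟩
    have key : t - sInf Pos ∈ Neg := by
      generalize sInf Pos = p at *
      refine ⟨by omega, ?_⟩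
      have S := hφ (t - p)
      have P := hφ p
      have e := hA (i + p) (t - p)
      rw [show i + p + (t - p) = i + t by omega] at e
      push_cast [Nat.cast_sub hp.le] at S ⊢
      rcases hA i p with h' | h'
      · have h2 := hG (i + t) (i + p)
        push_cast at h2
        rcases e with e | e <;> linarith
      · have h1 := (hA (i + p) n).resolve_left (by rw [hn]; exact hfirst p p0 hp)
        have h2 := hG (i + p + n) (i + n)
        push_cast at h2
        linarith
    have hq := Nat.sInf_le key
    exact Or.inr (Or.inr (fin ⟨_, tP⟩ ⟨_, key⟩ (by omega)))

variable {x : ℕ → ℤ}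

lemma HasSlope.return_mem {a : ℝ} (h : HasSlope x a) {n : ℕ} {v : ℤ} (hv : v ≤ n * a)
    (hv' : n * a < v + 1) :
    ∃ (L : Fin 3 → ℕ × ℤ), ∀ i ℓ c, ReturnAt x n v i ℓ c → ∃ s, (ℓ, c) = L s := by
  have hG : ∀ i j : ℕ, (prefixSum x i : ℝ) - i * a < prefixSum x j - j * a + 1 := by
    intro i j
    rcases le_total i j with hij | hij
    · have := h.1 i (j - i)
      rw [show i + (j - i) = j by omega, abs_lt] at this
      push_cast [Nat.cast_sub hij] at this
      linarith [this.1]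
    · have := h.1 j (i - j)
      rw [show j + (i - j) = i by omega, abs_lt] at this
      push_cast [Nat.cast_sub hij] at this
      linarith [this.2]
  have hA : ∀ i t : ℕ, (prefixSum x (i + t) : ℝ) = prefixSum x i + (⌊(t : ℝ) * a⌋ : ℝ) ∨
      (prefixSum x (i + t) : ℝ) = prefixSum x i + (⌊(t : ℝ) * a⌋ : ℝ) + 1 := by
    intro i t
    have h1 := h.1 i t
    have h2 := Int.floor_le ((t : ℝ) * a)
    have h3 := Int.lt_floor_add_one ((t : ℝ) * a)
    have h4 : t = 0 ∨ (⌊(t : ℝ) * a⌋ : ℝ) < (t : ℝ) * a := by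
      rcases Nat.eq_zero_or_pos t with h' | h'
      · exact Or.inl h'
      · exact Or.inr (lt_of_le_of_ne h2 (h.2 t h' _).symm)
    rcases h4 with rfl | h4
    · left; simp
    generalize ⌊(t : ℝ) * a⌋ = k at *
    rw [abs_lt] at h1
    have h5 : ((k : ℤ) : ℝ) < ((prefixSum x (i + t) - prefixSum x i + 1 : ℤ) : ℝ) := by
      push_cast at h1 ⊢; linarith
    have h6 : ((prefixSum x (i + t) - prefixSum x i : ℤ) : ℝ) < ((k + 2 : ℤ) : ℝ) := by
      push_cast at h1 ⊢; linarith
    rw [Int.cast_lt] at h5 h6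
    rcases (show prefixSum x (i + t) = prefixSum x i + k ∨
      prefixSum x (i + t) = prefixSum x i + k + 1 by omega) with h' | h'
    · left; exact_mod_cast h'
    · right; exact_mod_cast h'
  obtain ⟨p, q, hpq⟩ := return_mem_of_slope (A := fun i => (prefixSum x i : ℝ))
    (φ := fun t => (⌊(t : ℝ) * a⌋ : ℝ)) (v := v) (n := n) hG
    (fun t => ⟨Int.floor_le _, Int.lt_floor_add_one _⟩) hA
    (by rw [Int.floor_eq_iff.2 ⟨hv, hv'⟩])
  refine ⟨![(p, ⌊(p : ℝ) * a⌋ + 1), (q, ⌊(q : ℝ) * a⌋), (p + q, ⌊(p : ℝ) * a⌋ + ⌊(q : ℝ) * a⌋ + 1)],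
    fun i ℓ c hR => ?_⟩
  obtain ⟨h0, h1, h2, h3, h4⟩ := hR
  have := hpq i ℓ h0 (by exact_mod_cast (by omega : prefixSum x (i + n) = prefixSum x i + v))
    (by exact_mod_cast (by omega : prefixSum x (i + ℓ + n) = prefixSum x (i + ℓ) + v))
    (fun k k1 k2 hk => h4 k k1 k2 (by
      have : prefixSum x (i + k + n) = prefixSum x (i + k) + v := by exact_mod_cast hk
      omega))
  rcases this with ⟨e1, e2⟩ | ⟨e1, e2⟩ | ⟨e1, e2⟩
  · have e3 : prefixSum x (i + ℓ) = prefixSum x i + ⌊(p : ℝ) * a⌋ + 1 := by exact_mod_cast e2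
    exact ⟨0, Prod.ext e1 (by simp; omega)⟩
  · have e3 : prefixSum x (i + ℓ) = prefixSum x i + ⌊(q : ℝ) * a⌋ := by exact_mod_cast e2
    exact ⟨1, Prod.ext e1 (by simp; omega)⟩
  · have e3 : prefixSum x (i + ℓ) = prefixSum x i + ⌊(p : ℝ) * a⌋ + ⌊(q : ℝ) * a⌋ + 1 := by
      exact_mod_cast e2
    exact ⟨2, Prod.ext e1 (by simp; omega)⟩

lemma ReturnAt.compl {n : ℕ} {v : ℤ} {i ℓ : ℕ} {c : ℤ} (h : ReturnAt x n v i ℓ c) :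
    ReturnAt (fun k => 1 - x k) n (n - v) i ℓ (ℓ - c) :=
  ReturnAt.of_compl (by simpa using h)

/-- In a word of irrational slope every class of windows has at most three returns. -/
theorem HasSlope.exists_three_returns {a : ℝ} (h : HasSlope x a) (n : ℕ) (v : ℤ) :
    ∃ (L : Fin 3 → ℕ × ℤ), ∀ i ℓ c, ReturnAt x n v i ℓ c → ∃ s, (ℓ, c) = L s := by
  by_cases hne : ∃ i, prefixSum x (i + n) - prefixSum x i = v
  · obtain ⟨i, hi⟩ := hne
    have hw := h.1 i n
    rw [hi, abs_lt] at hw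
    rcases le_or_gt (v : ℝ) (n * a) with hv | hv
    · exact h.return_mem hv (by linarith)
    · obtain ⟨L, hL⟩ := h.compl.return_mem (n := n) (v := n - v) (by push_cast; linarith)
        (by push_cast; linarith)
      refine ⟨fun s => ((L s).1, (L s).1 - (L s).2), fun i ℓ c hR => ?_⟩
      obtain ⟨s, hs⟩ := hL _ _ _ hR.compl
      exact ⟨s, by simp [← hs]⟩
  · exact ⟨fun _ => (0, 0), fun i ℓ c hR => (hne ⟨i, hR.2.1⟩).elim⟩

end ThreeReturns

section Letters

variable {β : Type*} {w : ℕ → β}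

lemma Recurrent.exists_ge (h : Recurrent w) (i n N : ℕ) :
    ∃ j, N ≤ j ∧ ∀ k < n, w (j + k) = w (i + k) := by
  obtain ⟨j, hj, hj'⟩ := h (factorAt w i n) ⟨i, by simp⟩ N
  rw [length_factorAt, factorAt_eq_iff] at hj'
  exact ⟨j, hj, hj'⟩

lemma mem_abelianOccurrences_factorAt {i j n : ℕ} :
    i ∈ AbelianOccurrences w (factorAt w j n) ↔ (factorAt w i n).Perm (factorAt w j n) := by
  simp [AbelianOccurrences]

lemma factorAt_succ' (w : ℕ → β) (i n : ℕ) : factorAt w i (n + 1) = w i :: factorAt w (i + 1) n := by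
  simp only [factorAt, List.range_succ_eq_map, List.map_cons, List.map_map, add_zero]
  congr 1
  apply List.map_congr_left
  intro k _
  simp only [Function.comp, Nat.succ_eq_add_one]
  congr 1
  omega

lemma factorAt_perm_succ_iff {i n : ℕ} :
    (factorAt w (i + 1) n).Perm (factorAt w i n) ↔ w (i + n) = w i := by
  have h : (w i :: factorAt w (i + 1) n).Perm (w (i + n) :: factorAt w i n) := by
    rw [← factorAt_succ', factorAt_succ]
    exact List.perm_append_singleton _ _
  constructor
  · intro hp
    have h1 := h.trans (hp.symm.cons _)
    have h2 := (Multiset.cons_inj_left (factorAt w (i + 1) n : Multiset β)).1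
      (Multiset.coe_eq_coe.2 h1)
    exact h2.symm
  · intro he
    rw [he] at h
    exact (List.perm_cons _).1 h

lemma Recurrent.exists_next (h : Recurrent w) {u : List β} {i : ℕ} (hi : i ∈ AbelianOccurrences w u) :
    ∃ j, j ∈ AbelianOccurrences w u ∧ i < j ∧ ∀ k, i < k → k < j → k ∉ AbelianOccurrences w u := by
  have hex : ∃ j, i < j ∧ j ∈ AbelianOccurrences w u := by
    obtain ⟨j, hj, hj'⟩ := h.exists_ge i u.length (i + 1)
    refine ⟨j, hj, ?_⟩
    have : (factorAt w i u.length).Perm u := hi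
    rwa [← (factorAt_eq_iff w).2 hj'] at this
  classical
  exact ⟨Nat.find hex, (Nat.find_spec hex).2, (Nat.find_spec hex).1, fun k k1 k2 hk =>
    Nat.find_min hex k2 ⟨k1, hk⟩⟩

lemma abelianReturnClasses_nil :
    abelianReturnClasses w [] = (fun c : β => ({c} : Multiset β)) '' Set.range w := by
  have all : ∀ i, i ∈ AbelianOccurrences w [] := fun i => by simp [AbelianOccurrences, factorAt]
  ext m
  constructor
  · rintro ⟨_, ⟨i, j, -, -, hij, hn, rfl⟩, rfl⟩
    have : j = i + 1 := by
      by_contra hne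
      exact hn (i + 1) (by omega) (by omega) (all _)
    subst this
    exact ⟨w i, ⟨i, rfl⟩, by simp [factorAt]⟩
  · rintro ⟨_, ⟨i, rfl⟩, rfl⟩
    exact ⟨_, ⟨i, i + 1, all _, all _, by omega, fun k _ _ => by omega, rfl⟩, by simp [factorAt]⟩

/-- A recurrent word over three letters in which no factor has more than three abelian returns is
periodic. -/
lemma Recurrent.periodic_of_three_letters (h : Recurrent w) {a b c : β} (hab : a ≠ b)
    (hac : a ≠ c) (hbc : b ≠ c) (hw : Set.range w = {a, b, c})
    (h3 : ∀ u, IsFactor w u → (abelianReturnClasses w u).encard ≤ 3) : Periodic w := by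
  obtain ⟨ia, ha⟩ : a ∈ Set.range w := by simp [hw]
  obtain ⟨ib, hb⟩ : b ∈ Set.range w := by simp [hw]
  obtain ⟨ic, hc⟩ : c ∈ Set.range w := by simp [hw]
  obtain ⟨n, hn, hper⟩ := h.exists_ge 0 (ia + ib + ic + 1) 1
  have occ : ∀ i ≤ ia + ib + ic + 1, i ∈ AbelianOccurrences w (factorAt w 0 n) := by
    intro i
    induction i with
    | zero => intro _; rw [mem_abelianOccurrences_factorAt]
    | succ i ih =>
      intro hi
      have h1 := ih (by omega)
      rw [mem_abelianOccurrences_factorAt] at h1 ⊢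
      refine (factorAt_perm_succ_iff.2 ?_).trans h1
      rw [add_comm, hper i (by omega), zero_add]
  have single : ∀ i ≤ ia + ib + ic, ({w i} : Multiset β) ∈ abelianReturnClasses w (factorAt w 0 n) :=
    fun i hi => ⟨_, ⟨i, i + 1, occ _ (by omega), occ _ (by omega), by omega, fun k _ _ => by omega, rfl⟩,
      by simp [factorAt]⟩
  have sub : ({{a}, {b}, {c}} : Set (Multiset β)) ⊆ abelianReturnClasses w (factorAt w 0 n) := by
    rintro m (rfl | rfl | rfl)
    · exact ha ▸ single ia (by omega)
    · exact hb ▸ single ib (by omega)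
    · exact hc ▸ single ic (by omega)
  have card : ({{a}, {b}, {c}} : Set (Multiset β)).encard = 3 :=
    Set.encard_eq_three.2 ⟨_, _, _, by simpa using hab, by simpa using hac, by simpa using hbc, rfl⟩
  have eq := Set.Finite.eq_of_subset_of_encard_le (Set.toFinite _) sub (by
    rw [card]; exact h3 _ ⟨0, by rw [length_factorAt]⟩)
  have all : ∀ i, i ∈ AbelianOccurrences w (factorAt w 0 n) := by
    intro i
    induction i with
    | zero => exact occ 0 (by omega)
    | succ i ih =>
      obtain ⟨j, hj, hij, hk⟩ := h.exists_next ih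
      have mem : ((factorAt w i (j - i) : List β) : Multiset β) ∈
          abelianReturnClasses w (factorAt w 0 n) := ⟨_, ⟨i, j, ih, hj, hij, hk, rfl⟩, rfl⟩
      rw [← eq] at mem
      have : j - i = 1 := by
        rw [← length_factorAt w i (j - i), ← Multiset.coe_card]
        rcases mem with e | e | e <;> rw [e] <;> simp
      rwa [show i + 1 = j by omega]
  refine ⟨n, hn, fun i => ?_⟩
  have h1 := all i
  have h2 := all (i + 1)
  rw [mem_abelianOccurrences_factorAt] at h1 h2
  exact factorAt_perm_succ_iff.1 (h2.trans h1.symm)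

end Letters

section Coding

variable {β : Type*} {w : ℕ → β} {a b : β}

open Classical in
/-- The `0`-`1` word marking the occurrences of the letter `b`. -/
noncomputable def indicatorWord (w : ℕ → β) (b : β) (i : ℕ) : ℤ := if w i = b then 1 else 0

lemma isBinary_indicatorWord : IsBinary (indicatorWord w b) := fun i => by
  unfold indicatorWord
  split_ifs <;> simp

lemma indicatorWord_eq_iff (hw : ∀ i, w i = a ∨ w i = b) {i j : ℕ} :
    indicatorWord w b i = indicatorWord w b j ↔ w i = w j := by
  unfold indicatorWord
  constructor
  · intro h
    rcases hw i with hi | hi <;> rcases hw j with hj | hj <;> rw [hi, hj] at h ⊢ <;>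
      simp at h <;> first | exact h | exact h.symm
  · intro h
    rw [h]

lemma Recurrent.factorsRecur (hw : ∀ i, w i = a ∨ w i = b) (h : Recurrent w) :
    FactorsRecur (indicatorWord w b) := fun i n N => by
  obtain ⟨j, hj, hj'⟩ := h.exists_ge i n N
  exact ⟨j, hj, fun k hk => (indicatorWord_eq_iff hw).2 (hj' k hk)⟩

lemma Aperiodic.notEventuallyPeriodic (hw : ∀ i, w i = a ∨ w i = b) (hap : Aperiodic w)
    (h : Recurrent w) : NotEventuallyPeriodic (indicatorWord w b) := fun N T hT => by
  by_contra! hper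
  refine hap ⟨T, hT, fun m => ?_⟩
  obtain ⟨j, hj, hj'⟩ := h.exists_ge m (T + 1) N
  rw [← hj' T (by omega), (indicatorWord_eq_iff hw).1 (hper j hj)]
  exact hj' 0 (by omega)

lemma ncard_range_factorAt_indicatorWord (hw : ∀ i, w i = a ∨ w i = b) (n : ℕ) :
    (Set.range fun i => factorAt (indicatorWord w b) i n).ncard =
      (Set.range fun i => factorAt w i n).ncard := by
  classical
  have h1 : ∀ i, factorAt (indicatorWord w b) i n =
      (factorAt w i n).map fun c => if c = b then 1 else 0 := fun i => by
    simp only [factorAt, List.map_map]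
    refine List.map_congr_left fun k _ => ?_
    simp only [indicatorWord, Function.comp]
  have h2 : (Set.range fun i => factorAt (indicatorWord w b) i n) =
      (List.map fun c => if c = b then (1 : ℤ) else 0) '' Set.range fun i => factorAt w i n := by
    rw [← Set.range_comp]
    exact congrArg Set.range (funext h1)
  rw [h2]
  refine Set.InjOn.ncard_image ?_
  rintro _ ⟨i, rfl⟩ _ ⟨j, rfl⟩ h
  simp only [← h1] at h
  rw [factorAt_eq_iff] at h ⊢
  exact fun k hk => (indicatorWord_eq_iff hw).1 (h k hk)

open Classical in
lemma prefixSum_indicatorWord (i n : ℕ) : prefixSum (indicatorWord w b) (i + n) -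
    prefixSum (indicatorWord w b) i = ((factorAt w i n).count b : ℕ) := by
  induction n with
  | zero => simp [factorAt]
  | succ n ih =>
    rw [← add_assoc, prefixSum_succ, factorAt_succ, List.count_append]
    push_cast
    rw [← ih]
    unfold indicatorWord
    split_ifs with h
    · simp [h]; ring
    · simp [h]

lemma factorAt_perm_iff (hab : a ≠ b) (hw : ∀ i, w i = a ∨ w i = b) {i j n m : ℕ} :
    (factorAt w i n).Perm (factorAt w j m) ↔ n = m ∧
      prefixSum (indicatorWord w b) (i + n) - prefixSum (indicatorWord w b) i =
      prefixSum (indicatorWord w b) (j + m) - prefixSum (indicatorWord w b) j := by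
  classical
  rw [prefixSum_indicatorWord, prefixSum_indicatorWord]
  constructor
  · intro h
    exact ⟨by simpa using h.length_eq, by rw [h.count_eq]⟩
  · rintro ⟨rfl, h⟩
    have other : ∀ c, c ≠ a → c ≠ b → ∀ i, (factorAt w i n).count c = 0 := by
      intro c ca cb i
      rw [List.count_eq_zero]
      intro hc
      obtain ⟨k, -, hk⟩ := List.mem_map.1 hc
      rcases hw (i + k) with h | h
      · exact ca (hk.symm.trans h)
      · exact cb (hk.symm.trans h)
    have total : ∀ m i, (factorAt w i m).count a + (factorAt w i m).count b = m := by
      intro m i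
      induction m with
      | zero => simp [factorAt]
      | succ m ih =>
        rw [factorAt_succ, List.count_append, List.count_append]
        rcases hw (i + m) with hm | hm <;> rw [hm] <;> simp [hab, hab.symm] <;> omega
    rw [List.perm_iff_count]
    intro c
    by_cases hb : c = b
    · rw [hb]; exact_mod_cast h
    by_cases ha : c = a
    · have h1 := total n i
      have h2 := total n j
      have h3 : (factorAt w i n).count b = (factorAt w j n).count b := by exact_mod_cast h
      rw [ha]; omega
    · rw [other c ha hb, other c ha hb]

/-- The lengths and sums of the abelian returns of a class of factors. -/
lemma encard_abelianReturnClasses (hab : a ≠ b) (hw : ∀ i, w i = a ∨ w i = b) (j n : ℕ) :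
    (abelianReturnClasses w (factorAt w j n)).encard = {r : ℕ × ℤ | ∃ i, ReturnAt (indicatorWord w b) n
      (prefixSum (indicatorWord w b) (j + n) - prefixSum (indicatorWord w b) j) i r.1 r.2}.encard := by
  classical
  have occ : ∀ i, i ∈ AbelianOccurrences w (factorAt w j n) ↔
      prefixSum (indicatorWord w b) (i + n) - prefixSum (indicatorWord w b) i =
      prefixSum (indicatorWord w b) (j + n) - prefixSum (indicatorWord w b) j := fun i => by
    rw [mem_abelianOccurrences_factorAt, factorAt_perm_iff hab hw]
    simp
  let Φ : Multiset β → ℕ × ℤ := fun m => (m.card, m.count b)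
  have hΦ : ∀ i ℓ, Φ (factorAt w i ℓ : List β) =
      (ℓ, prefixSum (indicatorWord w b) (i + ℓ) - prefixSum (indicatorWord w b) i) := fun i ℓ => by
    rw [prefixSum_indicatorWord]
    simp [Φ]
  have inj : Set.InjOn Φ (abelianReturnClasses w (factorAt w j n)) := by
    rintro _ ⟨_, ⟨i, k, -, -, -, -, rfl⟩, rfl⟩ _ ⟨_, ⟨i', k', -, -, -, -, rfl⟩, rfl⟩ h
    dsimp only at h ⊢
    rw [hΦ, hΦ, Prod.mk.injEq] at h
    exact Multiset.coe_eq_coe.2 ((factorAt_perm_iff hab hw).2 h)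
  rw [← inj.encard_image]
  congr 1
  ext ⟨ℓ, c⟩
  constructor
  · rintro ⟨_, ⟨_, ⟨i, k, hi, hk, hik, hn, rfl⟩, rfl⟩, h⟩
    dsimp only at h
    rw [hΦ, Prod.mk.injEq] at h
    obtain ⟨rfl, rfl⟩ := h
    refine ⟨i, by dsimp only; omega, (occ i).1 hi, ?_, rfl, fun l l1 l2 => ?_⟩
    · dsimp only
      rw [show i + (k - i) = k by omega]
      exact (occ k).1 hk
    · exact fun h => hn (i + l) (by omega) (by dsimp only at l2; omega) ((occ _).2 h)
  · rintro ⟨i, h0, h1, h2, h3, h4⟩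
    refine ⟨_, ⟨_, ⟨i, i + ℓ, (occ _).2 h1, (occ _).2 h2, by dsimp only at h0; omega,
      fun k k1 k2 hk => ?_, rfl⟩, rfl⟩, ?_⟩
    · refine h4 (k - i) (by omega) (by dsimp only; omega) ?_
      rw [show i + (k - i) = k by omega]
      exact (occ k).1 hk
    · dsimp only
      rw [hΦ, show i + (i + ℓ - i) = i + ℓ by omega, show i + ℓ - i = ℓ by omega]
      exact Prod.ext rfl h3

lemma atMostThreeReturns_of_encard_le (hab : a ≠ b) (hw : ∀ i, w i = a ∨ w i = b)
    (h3 : ∀ u, IsFactor w u → (abelianReturnClasses w u).encard ≤ 3) :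
    AtMostThreeReturns (indicatorWord w b) := by
  intro n v i ℓ c hR
  have hle := h3 (factorAt w (i 0) n) ⟨i 0, by rw [length_factorAt]⟩
  rw [encard_abelianReturnClasses hab hw, (hR 0).2.1] at hle
  by_contra! hne
  have inj : Function.Injective fun t => (ℓ t, c t) := by
    intro t t' h
    obtain ⟨h1, h2⟩ := Prod.mk.inj h
    rcases lt_trichotomy t t' with hlt | heq | hlt
    · exact (hne t t' hlt h1 h2).elim
    · exact heq
    · exact (hne t' t hlt h1.symm h2.symm).elim
  have sub : (Set.range fun t => (ℓ t, c t)) ⊆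
      {r : ℕ × ℤ | ∃ i, ReturnAt (indicatorWord w b) n v i r.1 r.2} := by
    rintro _ ⟨t, rfl⟩
    exact ⟨i t, hR t⟩
  have := (Set.encard_le_encard sub).trans hle
  rw [← Set.image_univ, inj.encard_image, Set.encard_univ] at this
  simp at this
  norm_num at this

lemma encard_eq_of_isBalanced (hab : a ≠ b) (hw : ∀ i, w i = a ∨ w i = b)
    (hb : IsBalanced (indicatorWord w b)) (hr : FactorsRecur (indicatorWord w b))
    (hp : NotEventuallyPeriodic (indicatorWord w b)) {u : List β} (hu : IsFactor w u) :
    (abelianReturnClasses w u).encard = 2 ∨ (abelianReturnClasses w u).encard = 3 := by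
  obtain ⟨s, hs⟩ := hb.exists_hasSlope hr hp
  obtain ⟨j, hj⟩ := hu
  rw [← hj, encard_abelianReturnClasses hab hw]
  obtain ⟨i, i', ℓ, ℓ', c, c', hR, hR', hne⟩ := hs.exists_two_returns hr (n := u.length) (i := j) rfl
  obtain ⟨L, hL⟩ := hs.exists_three_returns u.length
    (prefixSum (indicatorWord w b) (j + u.length) - prefixSum (indicatorWord w b) j)
  generalize hS : {r : ℕ × ℤ | ∃ i, ReturnAt (indicatorWord w b) u.length
    (prefixSum (indicatorWord w b) (j + u.length) - prefixSum (indicatorWord w b) j) i r.1 r.2} = S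
  have lo : 1 < S.encard := Set.one_lt_encard_iff.2
    ⟨(ℓ, c), (ℓ', c'), hS ▸ ⟨i, hR⟩, hS ▸ ⟨i', hR'⟩, fun h => hne (Prod.mk.inj h)⟩
  have hi : S.encard ≤ 3 := by
    have sub : S ⊆ Set.range L := by
      rw [← hS]
      rintro ⟨ℓ, c⟩ ⟨i, h⟩
      obtain ⟨s, hs⟩ := hL _ _ _ h
      exact ⟨s, hs.symm⟩
    refine (Set.encard_le_encard sub).trans ?_
    rw [← Set.image_univ]
    refine (Set.encard_image_le _ _).trans ?_
    simp
  obtain ⟨k, hk⟩ := ENat.ne_top_iff_exists.1 (ne_top_of_le_ne_top (by simp) hi)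
  rw [← hk] at lo hi ⊢
  have h1 : 1 < k := by exact_mod_cast lo
  have h2 : k ≤ 3 := by exact_mod_cast hi
  rcases (show k = 2 ∨ k = 3 by omega) with rfl | rfl
  · exact Or.inl rfl
  · exact Or.inr rfl

end Coding

/-- Main theorem. An aperiodic recurrent infinite word is Sturmian if and
only if each of its factors has two or three abelian returns. -/
theorem sturmian_iff_two_or_three_abelian_returns {α : Type*} [Fintype α]
    (w : ℕ → α) (hap : Aperiodic w) (hrec : Recurrent w) :
    Sturmian w ↔ ∀ u : List α, IsFactor w u →
      (abelianReturnClasses w u).encard = 2 ∨ (abelianReturnClasses w u).encard = 3 := by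
  have letters : ∀ {a b : α}, Set.range w = {a, b} → ∀ i, w i = a ∨ w i = b := fun h i => by
    have : w i ∈ Set.range w := ⟨i, rfl⟩
    rwa [h] at this
  constructor
  · rintro ⟨-, hs⟩ u hu
    simp only [setOf_isFactor] at hs
    have h1 : (Set.range w).ncard = 2 := by
      refine Eq.trans ?_ (hs 1)
      rw [← Set.ncard_image_of_injective (Set.range w) (f := fun c => [c])
        (fun c d h => by simpa using h), ← Set.range_comp]
      simp [factorAt, Function.comp_def]
    obtain ⟨a, b, hab, hw⟩ := Set.ncard_eq_two.1 h1
    have hw := letters hw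
    have hp := hap.notEventuallyPeriodic hw hrec
    exact encard_eq_of_isBalanced hab hw (isBalanced_of_ncard_range_factorAt isBinary_indicatorWord hp
      fun n => by rw [ncard_range_factorAt_indicatorWord hw, hs]) (hrec.factorsRecur hw) hp hu
  · intro h
    have h3 : ∀ u, IsFactor w u → (abelianReturnClasses w u).encard ≤ 3 := fun u hu => by
      rcases h u hu with e | e <;> rw [e]
      norm_num
    have h0 := h [] ⟨0, rfl⟩
    rw [abelianReturnClasses_nil, Function.Injective.encard_image (fun c d => Multiset.singleton_inj.1)] at h0
    rcases h0 with h0 | h0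
    · obtain ⟨a, b, hab, hw⟩ := Set.encard_eq_two.1 h0
      have hw := letters hw
      have hr := hrec.factorsRecur hw
      have hp := hap.notEventuallyPeriodic hw hrec
      have hx : IsBinary (indicatorWord w b) := isBinary_indicatorWord
      have hb := (atMostThreeReturns_of_encard_le hab hw h3).isBalanced hx hr hp
      refine ⟨hap, fun n => ?_⟩
      rw [setOf_isFactor, ← ncard_range_factorAt_indicatorWord hw, hb.ncard_range_factorAt hx hr hp]
    · obtain ⟨a, b, c, hab, hac, hbc, hw⟩ := Set.encard_eq_three.1 h0
      exact (hap (hrec.periodic_of_three_letters hab hac hbc hw h3)).elim
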